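/- arXiv:1710.06131 — 2 statements merged into one kernel-verified Lean document; each statement's English description precedes it below -/
import Mathlib

section
/- Let q be a power of a prime p, let n ≥ 2 be an integer not divisible by p, and set T(x) = (x^n − 1)/(x − 1) ∈ F_q[x]. If W(T) · W(q^n − 1) < q^{n/2 − 1}, then there exists a primitive 1-normal element of F_{q^n} over F_q. -/
open Polynomial

noncomputable section

/-- For `f = Σ aᵢ xⁱ ∈ F_q[x]` and `α` in an extension, `f ∘ α = Σ aᵢ α^(qⁱ)`. -/
def frobComp {F K : Type*} [Field F] [Field K] [Algebra F K] (q : ℕ) (f : F[X]) (α : K) : K :=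
  ∑ i ∈ Finset.range (f.natDegree + 1), algebraMap F K (f.coeff i) * α ^ q ^ i

/-- `g` is the minimal polynomial of `α` with respect to the Frobenius `σ_q`:
monic, annihilates `α` under `∘`, and has least degree with these properties. -/
def IsFrobMinimal {F K : Type*} [Field F] [Field K] [Algebra F K] (q : ℕ) (g : F[X]) (α : K) :
    Prop :=
  g.Monic ∧ frobComp q g α = 0 ∧
    ∀ h : F[X], h.Monic → frobComp q h α = 0 → g.natDegree ≤ h.natDegree

/-- `α ∈ F_{qⁿ}` is `k`-normal over `F_q` if the `F_q`-span of `{α, α^q, …, α^(q^(n-1))}`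
has dimension `n - k`. -/
def IskNormal (q n k : ℕ) (F : Type*) {K : Type*} [Field F] [Field K] [Algebra F K] (α : K) :
    Prop :=
  Module.finrank F (Submodule.span F (Set.range fun i : Fin n => α ^ q ^ (i : ℕ))) = n - k

/-- `α` is primitive: it generates the multiplicative group of the field. -/
def IsPrimitiveElt {K : Type*} [Field K] (α : K) : Prop :=
  ∀ b : K, b ≠ 0 → ∃ m : ℕ, α ^ m = b

/-- `α` is `m`-free: `gcd(m, (xⁿ - 1)/m_{σ_q,α}) = 1`. -/
def IsPolyFree {F K : Type*} [Field F] [Field K] [Algebra F K] (q n : ℕ) (m : F[X]) (α : K) :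
    Prop :=
  ∀ g : F[X], IsFrobMinimal q g α → IsCoprime m ((X ^ n - 1) /ₘ g)

/-- `W(t)`: number of squarefree divisors of a positive integer `t`. -/
def Wint (t : ℕ) : ℕ := Set.ncard {d : ℕ | d ∣ t ∧ Squarefree d}

/-- `W(g)`: number of monic divisors of the polynomial `g`. -/
def Wpoly {F : Type*} [Field F] (g : F[X]) : ℕ := Set.ncard {h : F[X] | h.Monic ∧ h ∣ g}

/-- `Φ_q(f)`: number of units in `F_q[x]/⟨f⟩`. -/
def PhiPoly {F : Type*} [Field F] (f : F[X]) : ℕ := Nat.card (F[X] ⧸ Ideal.span {f})ˣ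



open Classical in
lemma sieveA {A : Type} [AddCommGroup A] [Finite A] {ι : Type} [Fintype ι]
    (H : ι → AddSubgroup A) (hH : ∀ i, H i ≠ ⊤)
    (hind : ∀ j x, ∃ y ∈ H j, ∃ z, (∀ i, i ≠ j → z ∈ H i) ∧ x = y + z) :
    ∃ (τ : Type) (_ : Fintype τ) (a : τ → ℂ) (ψ : τ → AddChar A ℂ) (t0 : τ),
      a t0 = 1 ∧ ψ t0 = 0 ∧ (∀ t, t ≠ t0 → ψ t ≠ 0) ∧
      (∑ t, ‖a t‖ = 2 ^ Fintype.card ι) ∧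
      ∀ x, (∑ t, a t * ψ t x) ≠ 0 → ∀ i, x ∉ H i := by
  let D : ι → Type := fun i => AddChar (A ⧸ H i) ℂ
  have : ∀ i, Fintype (D i) := fun i => Fintype.ofFinite _
  have hcard : ∀ i, (Fintype.card (D i)) = Nat.card (A ⧸ H i) := by
    intro i
    have : Fintype (A ⧸ H i) := Fintype.ofFinite _
    rw [Nat.card_eq_fintype_card]
    convert AddChar.card_eq (α := A ⧸ H i)
  have hcard2 : ∀ i, 2 ≤ Fintype.card (D i) := by
    intro i
    rw [hcard]
    have h1 : (H i).index ≠ 1 := by rw [Ne, AddSubgroup.index_eq_one]; exact hH i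
    have h2 : (H i).index ≠ 0 := AddSubgroup.index_ne_zero_of_finite
    change 2 ≤ (H i).index
    omega
  let c : ∀ i, D i → ℂ := fun i d => if d = 0 then 1 else -((Fintype.card (D i) : ℂ) - 1)⁻¹
  have hc0 : ∀ i, ((Fintype.card (D i) : ℂ) - 1) ≠ 0 := by
    intro i h
    have : (Fintype.card (D i) : ℂ) = 1 := by linear_combination h
    have h1 := hcard2 i
    have : Fintype.card (D i) = 1 := by exact_mod_cast this
    omega
  have hcnorm : ∀ i, ∑ d, ‖c i d‖ = 2 := by
    intro i
    rw [← Finset.add_sum_erase _ _ (Finset.mem_univ (0 : D i))]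
    have : ∀ d ∈ (Finset.univ.erase (0 : D i)), ‖c i d‖ = ((Fintype.card (D i) : ℝ) - 1)⁻¹ := by
      intro d hd
      have hd := Finset.ne_of_mem_erase hd
      simp only [c, hd, if_false, norm_neg, norm_inv]
      congr 1
      have : ((Fintype.card (D i) : ℂ) - 1) = (((Fintype.card (D i) : ℝ) - 1 : ℝ) : ℂ) := by
        push_cast; rfl
      rw [this, Complex.norm_real, Real.norm_of_nonneg]
      have := hcard2 i
      have : (2 : ℝ) ≤ Fintype.card (D i) := by exact_mod_cast this
      linarith
    rw [Finset.sum_congr rfl this, Finset.sum_const, Finset.card_erase_of_mem (Finset.mem_univ _)]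
    have h2 := hcard2 i
    have h3 : (2 : ℝ) ≤ Fintype.card (D i) := by exact_mod_cast h2
    simp only [c, if_true, norm_one, nsmul_eq_mul, Finset.card_univ]
    rw [Nat.cast_sub (by omega), Nat.cast_one, mul_inv_cancel₀ (by linarith)]
    norm_num
  have hcsum : ∀ i x, x ∈ H i → ∑ d, c i d * d (QuotientAddGroup.mk x) = 0 := by
    intro i x hx
    have : (QuotientAddGroup.mk x : A ⧸ H i) = 0 := by
      rwa [QuotientAddGroup.eq_zero_iff]
    rw [this]
    have h1 : ∀ d : D i, c i d * d (0 : A ⧸ H i) = c i d := fun d => by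
      have : d (0 : A ⧸ H i) = 1 := AddChar.map_zero_eq_one (A := A ⧸ H i) d
      rw [this, mul_one]
    rw [Finset.sum_congr rfl (fun d _ => h1 d)]
    rw [← Finset.add_sum_erase _ _ (Finset.mem_univ (0 : D i))]
    have : ∀ d ∈ (Finset.univ.erase (0 : D i)), c i d = -((Fintype.card (D i) : ℂ) - 1)⁻¹ := by
      intro d hd
      have hd := Finset.ne_of_mem_erase hd
      simp only [c, hd, if_false]
    rw [Finset.sum_congr rfl this, Finset.sum_const, Finset.card_erase_of_mem (Finset.mem_univ _)]
    have h2 := hcard2 i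
    simp only [c, if_true, nsmul_eq_mul, Finset.card_univ]
    rw [Nat.cast_sub (by omega), Nat.cast_one, mul_neg, mul_inv_cancel₀ (hc0 i)]
    norm_num
  refine ⟨∀ i, D i, inferInstance, fun t => ∏ i, c i (t i),
    fun t => ∑ i, (t i).compAddMonoidHom (QuotientAddGroup.mk' (H i)), fun _ => 0, ?_, ?_, ?_, ?_, ?_⟩
  · simp [c]
  · apply Finset.sum_eq_zero
    intro i _
    rfl
  · intro t ht
    obtain ⟨j, hj⟩ := Function.ne_iff.1 ht
    obtain ⟨w, hw⟩ := AddChar.ne_zero_iff.1 hj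
    obtain ⟨x, rfl⟩ := QuotientAddGroup.mk_surjective w
    obtain ⟨y, hy, z, hz, rfl⟩ := hind j x
    rw [AddChar.ne_zero_iff]
    refine ⟨z, ?_⟩
    rw [AddChar.sum_apply, Finset.prod_eq_single j]
    · have : (QuotientAddGroup.mk y : A ⧸ H j) = 0 := by
        rwa [QuotientAddGroup.eq_zero_iff]
      rw [QuotientAddGroup.mk_add, this, zero_add] at hw
      exact hw
    · intro i _ hi
      have : (QuotientAddGroup.mk z : A ⧸ H i) = 0 := by
        rw [QuotientAddGroup.eq_zero_iff]; exact hz i hi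
      simp [this]
    · simp
  · simp only [norm_prod]
    rw [← Fintype.prod_sum (fun i d => ‖c i d‖)]; simp [hcnorm]
  · intro x hx i hi
    apply hx
    have : ∏ i, ∑ d, c i d * d (QuotientAddGroup.mk x : A ⧸ H i) = 0 :=
      Finset.prod_eq_zero (Finset.mem_univ i) (hcsum i x hi)
    rw [Finset.prod_univ_sum, Fintype.piFinset_univ] at this
    rw [← this]
    apply Finset.sum_congr rfl
    intro t _
    rw [Finset.prod_mul_distrib, AddChar.sum_apply]
    rfl

lemma gaussNorm {K : Type} [Field K] [Fintype K] {χ : MulChar K ℂ} (hχ : χ ≠ 1) {e : AddChar K ℂ}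
    (he : e.IsPrimitive) : ‖gaussSum χ e‖ ^ 2 = (Fintype.card K : ℝ) := by
  have h1 := gaussSum_mul_gaussSum_eq_card hχ he
  rw [← star_gaussSum_eq] at h1
  have h2 := congrArg norm h1
  rw [norm_mul, norm_star, Complex.norm_natCast] at h2
  rw [← h2, sq]

open Classical in
lemma charBound {K : Type} [Field K] [Fintype K] (V : AddSubgroup K) (ψ : AddChar V ℂ)
    {χ : MulChar K ℂ} (hχ : χ ≠ 1) :
    ‖∑ v : V, ψ v * χ (v : K)‖ ≤ Real.sqrt (Fintype.card K) := by
  obtain ⟨e, he0⟩ := AddChar.exists_apply_ne_zero.2 (one_ne_zero : (1 : K) ≠ 0)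
  have he : e.IsPrimitive := AddChar.IsPrimitive.of_ne_one (AddChar.ne_one_iff.2 ⟨1, he0⟩)
  set G := gaussSum χ⁻¹ e with hG
  have hGn : ‖G‖ ^ 2 = (Fintype.card K : ℝ) := gaussNorm (inv_ne_one.2 hχ) he
  have hshift : ∀ x : K, χ x * G = ∑ y, χ⁻¹ y * e (x * y) := by
    intro x
    by_cases hx : x = 0
    · subst hx
      simp only [zero_mul, AddChar.map_zero_eq_one, mul_one]
      rw [MulChar.sum_eq_zero_of_ne_one (inv_ne_one.2 hχ), MulChar.map_zero, zero_mul]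
    · have := gaussSum_mulShift χ⁻¹ e (Units.mk0 x hx)
      rw [← hG] at this
      rw [← this, ← mul_assoc]
      have h3 : χ x * χ⁻¹ (Units.mk0 x hx : Kˣ) = 1 := by
        rw [Units.val_mk0, ← MulChar.mul_apply, mul_inv_cancel, MulChar.one_apply (Ne.isUnit hx)]
      rw [h3, one_mul]; rfl
  let φ : K → AddChar V ℂ := fun y => ψ * (AddChar.mulShift e y).compAddMonoidHom V.subtype
  have key : (∑ v : V, ψ v * χ (v : K)) * G = ∑ y, χ⁻¹ y * ∑ v : V, φ y v := by
    rw [Finset.sum_mul]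
    simp_rw [Finset.mul_sum]
    rw [Finset.sum_comm]
    apply Finset.sum_congr rfl
    intro v _
    rw [mul_assoc, hshift, Finset.mul_sum]
    apply Finset.sum_congr rfl
    intro y _
    simp [φ, AddChar.mulShift_apply, mul_comm y]
    ring
  have hreal : ∀ y, ((‖∑ v : V, φ y v‖ : ℝ) : ℂ) = ∑ v : V, φ y v := by
    intro y
    rw [AddChar.sum_eq_ite]
    split_ifs <;> simp
  have hsum : ∑ y, ∑ v : V, φ y v = (Fintype.card K : ℂ) := by
    rw [Finset.sum_comm, Finset.sum_eq_single 0]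
    · simp [φ, AddChar.mulShift_apply]
    · intro v _ hv
      have : ∑ y, e (y * (v : K)) = 0 := by
        have h4 := AddChar.sum_mulShift (v : K) he
        rw [if_neg (by simpa using hv)] at h4
        simpa using h4
      simp only [φ, AddChar.mul_apply, AddChar.compAddMonoidHom_apply, AddChar.mulShift_apply,
        AddSubgroup.coe_subtype]
      rw [← Finset.mul_sum, this, mul_zero]
    · simp
  have hsumR : ∑ y, ‖∑ v : V, φ y v‖ = (Fintype.card K : ℝ) := by
    have : ((∑ y, ‖∑ v : V, φ y v‖ : ℝ) : ℂ) = ((Fintype.card K : ℝ) : ℂ) := by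
      push_cast
      simp_rw [hreal]
      exact hsum
    exact_mod_cast this
  have hχn : ∀ y, ‖χ⁻¹ y‖ ≤ 1 := fun y => by
    by_cases hy : y = 0
    · subst hy; rw [MulChar.map_zero]; simp
    · refine le_of_eq (Complex.norm_eq_one_of_pow_eq_one (n := Fintype.card K - 1) ?_ ?_)
      · rw [← map_pow, FiniteField.pow_card_sub_one_eq_one y hy, map_one]
      · have := Fintype.one_lt_card (α := K)
        omega
  have hle : ‖∑ v : V, ψ v * χ (v : K)‖ * ‖G‖ ≤ Fintype.card K := by
    rw [← norm_mul, key, ← hsumR]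
    refine (norm_sum_le _ _).trans (Finset.sum_le_sum fun y _ => ?_)
    rw [norm_mul]
    exact mul_le_of_le_one_left (norm_nonneg _) (hχn y)
  have hcp : (0 : ℝ) < Fintype.card K := by exact_mod_cast Fintype.card_pos
  have hGs : ‖G‖ = Real.sqrt (Fintype.card K) := by
    rw [← hGn, Real.sqrt_sq (norm_nonneg _)]
  rw [hGs] at hle
  have hs : 0 < Real.sqrt (Fintype.card K) := Real.sqrt_pos.2 hcp
  have := Real.mul_self_sqrt hcp.le
  nlinarith

def toMulChar {K : Type} [Field K] (χ : AddChar (Additive Kˣ) ℂ) : MulChar K ℂ :=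
  MulChar.ofUnitHom (MonoidHom.toHomUnits
    { toFun := fun u => χ (Additive.ofMul u)
      map_one' := χ.map_zero_eq_one
      map_mul' := fun a b => χ.map_add_eq_mul _ _ })

lemma toMulChar_apply {K : Type} [Field K] (χ : AddChar (Additive Kˣ) ℂ) (u : Kˣ) :
    toMulChar χ u = χ (Additive.ofMul u) := by
  simp [toMulChar]

lemma toMulChar_zero {K : Type} [Field K] : toMulChar (0 : AddChar (Additive Kˣ) ℂ) = 1 := by
  ext u
  rw [toMulChar_apply]
  simp

lemma toMulChar_ne {K : Type} [Field K] {χ : AddChar (Additive Kˣ) ℂ} (h : χ ≠ 0) :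
    toMulChar χ ≠ 1 := by
  intro h1
  apply h
  ext u
  have := toMulChar_apply χ u.toMul
  rw [h1] at this
  simpa using this.symm

open Classical in
lemma sumOne {K : Type} [Field K] [Fintype K] (V : AddSubgroup K) (ψ : AddChar V ℂ) :
    ∑ v : V, ψ v * (1 : MulChar K ℂ) (v : K) = (∑ v : V, ψ v) - 1 := by
  rw [← Finset.add_sum_erase _ _ (Finset.mem_univ (0 : V)),
    ← Finset.add_sum_erase _ (fun v => ψ v) (Finset.mem_univ (0 : V))]
  have : ∀ v ∈ Finset.univ.erase (0 : V), ψ v * (1 : MulChar K ℂ) (v : K) = ψ v := by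
    intro v hv
    have hv : (v : K) ≠ 0 := by simpa using Finset.ne_of_mem_erase hv
    rw [MulChar.one_apply (Ne.isUnit hv), mul_one]
  rw [Finset.sum_congr rfl this]
  simp
  exact MulChar.map_zero _

open Classical in
lemma combine {K : Type} [Field K] [Fintype K] (V : AddSubgroup K)
    {ι : Type} [Fintype ι] (H : ι → AddSubgroup V) (hH : ∀ i, H i ≠ ⊤)
    (hind : ∀ j x, ∃ y ∈ H j, ∃ z, (∀ i, i ≠ j → z ∈ H i) ∧ x = y + z)
    {κ : Type} [Fintype κ] (M : κ → AddSubgroup (Additive Kˣ)) (hM : ∀ i, M i ≠ ⊤)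
    (hMind : ∀ j x, ∃ y ∈ M j, ∃ z, (∀ i, i ≠ j → z ∈ M i) ∧ x = y + z)
    (hineq : (2 : ℝ) ^ Fintype.card ι * 2 ^ Fintype.card κ * Real.sqrt (Fintype.card K)
      < Nat.card V) :
    ∃ (u : Kˣ) (h : (u : K) ∈ V), (∀ i, (⟨u, h⟩ : V) ∉ H i) ∧ ∀ j, Additive.ofMul u ∉ M j := by
  obtain ⟨τ, _, a, ψ, t0, ha0, hψ0, hψ, ha, haz⟩ := sieveA H hH hind
  obtain ⟨σ, _, b, χ, s0, hb0, hχ0, hχ, hb, hbz⟩ := sieveA M hM hMind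
  set R := Real.sqrt (Fintype.card K) with hR
  have hR1 : 1 ≤ R := by
    rw [hR, Real.one_le_sqrt]
    exact_mod_cast Fintype.card_pos
  by_contra hcon
  have hzero : ∑ v : V, (∑ t, a t * ψ t v) * (∑ s, b s * toMulChar (χ s) (v : K)) = 0 := by
    apply Finset.sum_eq_zero
    intro v _
    by_contra hne
    have h1 := left_ne_zero_of_mul hne
    have h2 := right_ne_zero_of_mul hne
    have hv : (v : K) ≠ 0 := by
      intro hv
      apply h2
      apply Finset.sum_eq_zero
      intro s _
      rw [hv, MulChar.map_zero, mul_zero]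
    apply hcon
    refine ⟨Units.mk0 (v : K) hv, v.2, haz v h1, hbz _ ?_⟩
    have h3 : ∀ s, toMulChar (χ s) (v : K) = χ s (Additive.ofMul (Units.mk0 (v : K) hv)) :=
      fun s => toMulChar_apply (χ s) (Units.mk0 (v : K) hv)
    simpa only [h3] using h2
  let S : τ × σ → ℂ := fun x => ∑ v : V, ψ x.1 v * toMulChar (χ x.2) (v : K)
  have hexp : ∑ x : τ × σ, a x.1 * b x.2 * S x = 0 := by
    rw [← hzero]
    simp only [S, Finset.mul_sum]
    rw [Finset.sum_comm]
    apply Finset.sum_congr rfl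
    intro v _
    rw [← Finset.mul_sum, Finset.sum_mul_sum, ← Finset.univ_product_univ, Finset.sum_product]
    apply Finset.sum_congr rfl
    intro t _
    apply Finset.sum_congr rfl
    intro s _
    ring
  have hS0 : S (t0, s0) = (Nat.card V : ℂ) - 1 := by
    simp only [S, hψ0, hχ0, toMulChar_zero]
    rw [sumOne]
    simp
  have hS : ∀ x, x ≠ (t0, s0) → ‖S x‖ ≤ R := by
    rintro ⟨t, s⟩ hx
    by_cases hs : s = s0
    · have ht : t ≠ t0 := by rintro rfl; exact hx (by rw [hs])
      simp only [S, hs, hχ0, toMulChar_zero]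
      rw [sumOne, AddChar.sum_eq_zero_iff_ne_zero.2 (hψ t ht)]
      simpa using hR1
    · exact charBound V (ψ t) (toMulChar_ne (hχ s hs))
  have hn : ∑ x : τ × σ, ‖a x.1‖ * ‖b x.2‖ = 2 ^ Fintype.card ι * 2 ^ Fintype.card κ := by
    rw [← ha, ← hb, Finset.sum_mul_sum, ← Finset.univ_product_univ, Finset.sum_product]
  rw [← Finset.add_sum_erase _ _ (Finset.mem_univ (t0, s0))] at hn hexp
  simp only [ha0, hb0, norm_one, mul_one, one_mul, hS0] at hn hexp
  have hb1 : ‖∑ x ∈ Finset.univ.erase (t0, s0), a x.1 * b x.2 * S x‖ ≤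
      (∑ x ∈ Finset.univ.erase (t0, s0), ‖a x.1‖ * ‖b x.2‖) * R := by
    rw [Finset.sum_mul]
    refine (norm_sum_le _ _).trans (Finset.sum_le_sum fun x hx => ?_)
    rw [norm_mul, norm_mul]
    exact mul_le_mul_of_nonneg_left (hS x (Finset.ne_of_mem_erase hx)) (by positivity)
  have hb2 : (Nat.card V : ℝ) - 1 ≤ ‖∑ x ∈ Finset.univ.erase (t0, s0), a x.1 * b x.2 * S x‖ := by
    rw [eq_neg_of_add_eq_zero_right hexp, norm_neg]
    have := Complex.re_le_norm ((Nat.card V : ℂ) - 1)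
    simpa using this
  have : (∑ x ∈ Finset.univ.erase (t0, s0), ‖a x.1‖ * ‖b x.2‖) =
    2 ^ Fintype.card ι * 2 ^ Fintype.card κ - 1 := by linarith
  rw [this] at hb1
  nlinarith

def powSub (K : Type) [Field K] (l : ℕ) : AddSubgroup (Additive Kˣ) :=
  (nsmulAddMonoidHom (α := Additive Kˣ) l).range

lemma mem_powSub {K : Type} [Field K] (l : ℕ) (u : Kˣ) :
    Additive.ofMul u ∈ powSub K l ↔ ∃ w : Kˣ, w ^ l = u := by
  constructor
  · rintro ⟨w, hw⟩
    exact ⟨w.toMul, hw⟩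
  · rintro ⟨w, rfl⟩
    exact ⟨Additive.ofMul w, rfl⟩

lemma powSub_ne_top {K : Type} [Field K] [Fintype K] {l : ℕ} (hl : l.Prime)
    (hd : l ∣ Nat.card Kˣ) : powSub K l ≠ ⊤ := by
  intro h
  have : Fact l.Prime := ⟨hl⟩
  obtain ⟨x, hx⟩ := exists_prime_orderOf_dvd_card' l hd
  have hsurj : Function.Surjective (fun w : Kˣ => w ^ l) := by
    intro u
    have : Additive.ofMul u ∈ powSub K l := by rw [h]; trivial
    exact (mem_powSub l u).1 this
  have hinj := Finite.injective_iff_surjective.2 hsurj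
  have : x = 1 := hinj (by simp only [one_pow]; rw [← hx, pow_orderOf_eq_one])
  rw [this, orderOf_one] at hx
  exact hl.one_lt.ne hx

lemma powSub_ind {K : Type} [Field K] (N : ℕ) (j : N.primeFactors)
    (x : Additive Kˣ) :
    ∃ y ∈ powSub K (j : ℕ), ∃ z, (∀ i : N.primeFactors, i ≠ j → z ∈ powSub K (i : ℕ)) ∧ x = y + z := by
  have hj := Nat.prime_of_mem_primeFactors j.2
  set L := ∏ i ∈ N.primeFactors.erase (j : ℕ), i with hL
  have hc : IsCoprime ((j : ℕ) : ℤ) (L : ℤ) := by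
    rw [Nat.isCoprime_iff_coprime, hL]
    apply Nat.Coprime.prod_right
    intro i hi
    exact (Nat.coprime_primes hj (Nat.prime_of_mem_primeFactors (Finset.mem_of_mem_erase hi))).2
      (Finset.ne_of_mem_erase hi).symm
  obtain ⟨a, b, hab⟩ := hc
  refine ⟨(j : ℕ) • (a • x), ⟨a • x, rfl⟩, L • (b • x), ?_, ?_⟩
  · intro i hi
    have : (i : ℕ) ∣ L := Finset.dvd_prod_of_mem _
      (Finset.mem_erase.2 ⟨fun h => hi (Subtype.ext h), i.2⟩)
    obtain ⟨c, hc⟩ := this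
    refine ⟨c • (b • x), ?_⟩
    rw [hc, mul_nsmul']
    rfl
  · rw [← natCast_zsmul, ← natCast_zsmul, smul_smul, smul_smul, ← add_zsmul, mul_comm _ a, mul_comm _ b, hab,
      one_zsmul]

lemma primitive_of {K : Type} [Field K] [Fintype K] (u : Kˣ)
    (h : ∀ l ∈ (Nat.card Kˣ).primeFactors, Additive.ofMul u ∉ powSub K l) :
    IsPrimitiveElt (u : K) := by
  obtain ⟨g, hg⟩ := IsCyclic.exists_generator (α := Kˣ)
  obtain ⟨k, hk⟩ := (mem_powers_iff_mem_zpowers).2 (hg u)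
  have hog : orderOf g = Nat.card Kˣ := orderOf_eq_card_of_forall_mem_zpowers hg
  have hco : (orderOf g).Coprime k := by
    rw [hog]
    apply Nat.Coprime.symm
    apply Nat.coprime_of_dvd
    intro l hl hlk hlN
    apply h l (Nat.mem_primeFactors.2 ⟨hl, hlN, Nat.card_pos.ne'⟩)
    obtain ⟨m, rfl⟩ := hlk
    rw [mem_powSub]
    exact ⟨g ^ m, by rw [← hk]; simp only; rw [← pow_mul, mul_comm]⟩
  have hou : orderOf u = Nat.card Kˣ := by
    rw [← hk]; simp only; rw [Nat.Coprime.orderOf_pow hco, hog]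
  intro b hb
  have : Units.mk0 b hb ∈ Submonoid.powers u := by
    rw [mem_powers_iff_mem_zpowers, (Subgroup.eq_top_of_card_eq (Subgroup.zpowers u)
      (by rw [Nat.card_zpowers, hou]))]
    trivial
  obtain ⟨m, hm⟩ := this
  refine ⟨m, ?_⟩
  have := congrArg Units.val hm
  simpa using this

lemma Wint_ge {N : ℕ} (hN : N ≠ 0) : 2 ^ N.primeFactors.card ≤ Wint N := by
  rw [← Finset.card_powerset, Wint, ← Set.ncard_coe_finset]
  refine Set.ncard_le_ncard_of_injOn (fun s => ∏ i ∈ s, i) ?_ ?_ ?_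
  · intro s hs
    have hs : s ⊆ N.primeFactors := by simpa using hs
    constructor
    · exact (Finset.prod_dvd_prod_of_subset _ _ _ hs).trans (Nat.prod_primeFactors_dvd N)
    · apply Finset.squarefree_prod_of_pairwise_isCoprime
      · intro i hi j hj hij
        simp only [Function.onFun]
        exact (Nat.coprime_iff_isRelPrime).1 ((Nat.coprime_primes (Nat.prime_of_mem_primeFactors (hs hi))
          (Nat.prime_of_mem_primeFactors (hs hj))).2 hij)
      · intro i hi
        exact (Nat.prime_of_mem_primeFactors (hs hi)).prime.squarefree
  · intro s hs t ht hst
    have hs : s ⊆ N.primeFactors := by simpa using hs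
    have ht : t ⊆ N.primeFactors := by simpa using ht
    rw [← Nat.primeFactors_prod (s := s) fun i hi => Nat.prime_of_mem_primeFactors (hs hi),
      ← Nat.primeFactors_prod (s := t) fun i hi => Nat.prime_of_mem_primeFactors (ht hi)]
    exact congrArg _ hst
  · exact (Set.finite_le_nat N).subset fun d hd => Nat.le_of_dvd (Nat.pos_of_ne_zero hN) hd.1

open UniqueFactorizationMonoid in
open Classical in
def irrF {F : Type} [Field F] (T : F[X]) : Finset F[X] := (normalizedFactors T).toFinset

open UniqueFactorizationMonoid in
lemma mem_irrF {F : Type} [Field F] {T : F[X]} (hT : T ≠ 0) {P : F[X]} :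
    P ∈ irrF T ↔ Irreducible P ∧ P.Monic ∧ P ∣ T := by
  classical
  rw [irrF, Multiset.mem_toFinset]
  constructor
  · intro h
    have h1 := irreducible_of_normalized_factor P h
    refine ⟨h1, ?_, dvd_of_mem_normalizedFactors h⟩
    have h2 := normalize_normalized_factor P h
    rw [← h2]
    exact monic_normalize h1.ne_zero
  · rintro ⟨h1, h2, h3⟩
    rw [mem_normalizedFactors_iff' hT]
    exact ⟨h1, h2.normalize_eq_self, h3⟩

lemma eq_of_dvd_irr {F : Type} [Field F] {P R : F[X]} (hP : Irreducible P) (hP1 : P.Monic)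
    (hR : Irreducible R) (hR1 : R.Monic) (h : P ∣ R) : P = R :=
  eq_of_monic_of_associated hP1 hR1 (hP.associated_of_dvd hR h)

lemma Wpoly_ge {F : Type} [Field F] [Fintype F] {T : F[X]} (hT : T ≠ 0) :
    2 ^ (irrF T).card ≤ Wpoly T := by
  classical
  rw [← Finset.card_powerset, Wpoly, ← Set.ncard_coe_finset]
  refine Set.ncard_le_ncard_of_injOn (fun s => ∏ i ∈ s, i) ?_ ?_ ?_
  · intro s hs
    have hs : s ⊆ irrF T := by simpa using hs
    refine ⟨monic_prod_of_monic _ _ fun i hi => ((mem_irrF hT).1 (hs hi)).2.1, ?_⟩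
    apply Finset.prod_dvd_of_coprime
    · intro i hi j hj hij
      obtain ⟨h1, h2, h3⟩ := (mem_irrF hT).1 (hs hi)
      obtain ⟨k1, k2, k3⟩ := (mem_irrF hT).1 (hs hj)
      exact (h1.coprime_iff_not_dvd).2 fun h => hij (eq_of_dvd_irr h1 h2 k1 k2 h)
    · intro i hi
      exact ((mem_irrF hT).1 (hs hi)).2.2
  · have key : ∀ s ⊆ irrF T, ∀ P ∈ irrF T, P ∈ s ↔ P ∣ ∏ i ∈ s, i := by
      intro s hs P hP
      refine ⟨fun h => Finset.dvd_prod_of_mem _ h, fun h => ?_⟩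
      obtain ⟨h1, h2, h3⟩ := (mem_irrF hT).1 hP
      obtain ⟨i, hi, hd⟩ := (h1.prime.dvd_finsetProd_iff _).1 h
      obtain ⟨k1, k2, k3⟩ := (mem_irrF hT).1 (hs hi)
      rwa [eq_of_dvd_irr h1 h2 k1 k2 hd]
    intro s hs t ht hst
    have hs : s ⊆ irrF T := by simpa using hs
    have ht : t ⊆ irrF T := by simpa using ht
    simp only at hst
    ext P
    constructor
    · intro h
      have := hs h
      rw [key t ht P this, ← hst, ← key s hs P this]
      exact h
    · intro h
      have := ht h
      rw [key s hs P this, hst, ← key t ht P this]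
      exact h
  · have : Finite (degreeLT F (T.natDegree + 1)) := Module.finite_of_finite F
    refine (Set.toFinite (degreeLT F (T.natDegree + 1) : Set F[X])).subset ?_
    rintro h ⟨_, hd⟩
    rw [SetLike.mem_coe, mem_degreeLT]
    refine (degree_le_of_dvd hd hT).trans_lt ?_
    rw [degree_eq_natDegree hT]
    exact_mod_cast Nat.lt_succ_self _

abbrev frb (F K : Type) [Field F] [Fintype F] [Field K] [Algebra F K] : Module.End F K :=
  (FiniteField.frobeniusAlgHom F K).toLinearMap

lemma frb_pow {F K : Type} [Field F] [Fintype F] [Field K] [Algebra F K] (i : ℕ) (x : K) :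
    ((frb F K) ^ i) x = x ^ (Fintype.card F) ^ i := by
  induction i with
  | zero => simp
  | succ i ih => 
    rw [pow_succ', Module.End.mul_apply, ih, pow_succ, pow_mul]
    rfl

section
variable {F K : Type} [Field F] [Field K] [Algebra F K] (s : Module.End F K)

lemma aeval_kill {f g : F[X]} (h : f ∣ g) {x : K} (hx : aeval s f x = 0) : aeval s g x = 0 := by
  obtain ⟨c, rfl⟩ := h
  rw [mul_comm, map_mul, Module.End.mul_apply, hx, map_zero]

def VV (T : F[X]) : AddSubgroup K := (LinearMap.ker (aeval s T)).toAddSubgroup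

lemma mem_VV {T : F[X]} {x : K} : x ∈ VV s T ↔ aeval s T x = 0 := Iff.rfl

lemma HH_ne_top {T P Q : F[X]} (hT0 : T ≠ 0) (hmin : (X - 1) * T = minpoly F s)
    (hP : Irreducible P) (hTQ : T = P * Q) : (VV s Q).addSubgroupOf (VV s T) ≠ ⊤ := by
  intro h
  have h1 : ∀ x, aeval s T x = 0 → aeval s Q x = 0 := by
    intro x hx
    have : (⟨x, hx⟩ : VV s T) ∈ (VV s Q).addSubgroupOf (VV s T) := by rw [h]; trivial
    exact this
  have h2 : aeval s ((X - 1) * Q) = 0 := by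
    ext x
    rw [mul_comm, map_mul, Module.End.mul_apply, LinearMap.zero_apply]
    apply h1
    rw [← Module.End.mul_apply, ← map_mul, mul_comm, hmin, minpoly.aeval]
    rfl
  have h3 := minpoly.dvd F s h2
  have h4 : (X - 1 : F[X]) ≠ 0 := X_sub_C_ne_zero 1
  rw [← hmin, mul_dvd_mul_iff_left h4, hTQ] at h3
  have hQ : Q ≠ 0 := by rintro rfl; exact hT0 (by rw [hTQ, mul_zero])
  have h5 : P * Q ∣ 1 * Q := by rwa [one_mul]
  rw [mul_dvd_mul_iff_right hQ] at h5
  exact hP.not_isUnit (isUnit_of_dvd_one h5)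

lemma HH_ind {T : F[X]} (hT0 : T ≠ 0) (hsq : Squarefree T) (Q : irrF T → F[X])
    (hQ : ∀ P, T = P * Q P) (j : irrF T) (x : VV s T) :
    ∃ y ∈ (VV s (Q j)).addSubgroupOf (VV s T), ∃ z,
      (∀ i, i ≠ j → z ∈ (VV s (Q i)).addSubgroupOf (VV s T)) ∧ x = y + z := by
  have hc : IsCoprime (j : F[X]) (Q j) := by
    rw [hQ j] at hsq
    exact IsRelPrime.isCoprime (squarefree_mul_iff.1 hsq).1
  obtain ⟨a, b, hab⟩ := hc
  have hx : aeval s T (x : K) = 0 := x.2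
  have hm : ∀ c : F[X], aeval s c (x : K) ∈ VV s T := by
    intro c
    rw [mem_VV, ← Module.End.mul_apply, ← map_mul]
    exact aeval_kill s (Dvd.intro _ rfl) hx
  refine ⟨⟨_, hm (a * j)⟩, ?_, ⟨_, hm (b * Q j)⟩, ?_, ?_⟩
  · rw [AddSubgroup.mem_addSubgroupOf, mem_VV]
    simp only
    rw [← Module.End.mul_apply, ← map_mul]
    refine aeval_kill s ⟨a, ?_⟩ hx
    linear_combination (-a) * hQ j
  · intro i hi
    rw [AddSubgroup.mem_addSubgroupOf, mem_VV]
    simp only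
    rw [← Module.End.mul_apply, ← map_mul]
    obtain ⟨h1, h2, h3⟩ := (mem_irrF hT0).1 i.2
    obtain ⟨k1, k2, k3⟩ := (mem_irrF hT0).1 j.2
    have : (j : F[X]) ∣ Q i := by
      have h4 : (j : F[X]) ∣ i * Q i := k3.trans (dvd_of_eq (hQ i))
      rcases k1.prime.dvd_or_dvd h4 with h5 | h5
      · exact absurd (Subtype.ext (eq_of_dvd_irr k1 k2 h1 h2 h5).symm) hi
      · exact h5
    obtain ⟨c, hc⟩ := this
    refine aeval_kill s ⟨c * b, ?_⟩ hx
    rw [hc]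
    linear_combination (-c * b) * hQ j
  · apply Subtype.ext
    change (x : K) = aeval s (a * (j : F[X])) (x : K) + aeval s (b * Q j) (x : K)
    rw [← LinearMap.add_apply, ← map_add, hab, map_one]
    rfl

lemma dvd_of_free {T : F[X]} (hT0 : T ≠ 0) (Q : irrF T → F[X])
    (hQ : ∀ P, T = P * Q P) {α : K} (hα : aeval s T α = 0) (hf : ∀ P, aeval s (Q P) α ≠ 0)
    {h : F[X]} (hh : aeval s h α = 0) : T ∣ h := by
  classical
  set g := EuclideanDomain.gcd h T with hg
  have hgk : aeval s g α = 0 := by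
    rw [hg, EuclideanDomain.gcd_eq_gcd_ab, map_add, LinearMap.add_apply,
      aeval_kill s (Dvd.intro _ rfl) hh, aeval_kill s (Dvd.intro _ rfl) hα, add_zero]
  obtain ⟨c, hc⟩ := EuclideanDomain.gcd_dvd_right h T
  rw [← hg] at hc
  have hc0 : c ≠ 0 := by rintro rfl; exact hT0 (by rw [hc, mul_zero])
  by_cases hu : IsUnit c
  · have : T ∣ g := by
      rw [hc]; exact hu.mul_right_dvd.2 dvd_rfl
    exact this.trans (EuclideanDomain.gcd_dvd_left h T)
  · exfalso
    obtain ⟨P, hP, hPm, hPc⟩ := exists_monic_irreducible_factor c hu |>.imp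
      fun P h => (⟨h.2.1, h.1, h.2.2⟩ : Irreducible P ∧ P.Monic ∧ P ∣ c)
    have hmem : P ∈ irrF T := (mem_irrF hT0).2 ⟨hP, hPm, hPc.trans (Dvd.intro_left _ hc.symm)⟩
    apply hf ⟨P, hmem⟩
    obtain ⟨d, hd⟩ := hPc
    refine aeval_kill s ⟨d, ?_⟩ hgk
    apply mul_left_cancel₀ hP.ne_zero
    have := hQ ⟨P, hmem⟩
    simp only at this
    rw [← this, hc, hd]
    ring

lemma finrank_of_free {T : F[X]} (hT : T.Monic) {m n : ℕ} (hm : T.natDegree = m) (hmn : m ≤ n)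
    {α : K} (hα : aeval s T α = 0)
    (hd : ∀ h : F[X], aeval s h α = 0 → T ∣ h) :
    Module.finrank F (Submodule.span F (Set.range fun i : Fin n => (s ^ (i : ℕ)) α)) = m := by
  let φ : F[X] →ₗ[F] K := (LinearMap.applyₗ α).comp (aeval s).toLinearMap
  have hφ : ∀ h, φ h = aeval s h α := fun h => rfl
  let ψ : degreeLT F m →ₗ[F] K := φ.comp (degreeLT F m).subtype
  have hψ : ∀ h, ψ h = aeval s (h : F[X]) α := fun h => rfl
  have hinj : Function.Injective ψ := by
    rw [← LinearMap.ker_eq_bot, LinearMap.ker_eq_bot']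
    intro h hh
    have h1 := hd _ hh
    apply Subtype.ext
    apply eq_zero_of_dvd_of_degree_lt h1
    rw [degree_eq_natDegree hT.ne_zero, hm]
    exact mem_degreeLT.1 h.2
  have hr : Submodule.span F (Set.range fun i : Fin n => (s ^ (i : ℕ)) α) = LinearMap.range ψ := by
    apply le_antisymm
    · rw [Submodule.span_le]
      rintro _ ⟨i, rfl⟩
      have hlt : (X ^ (i : ℕ) %ₘ T) ∈ degreeLT F m := by
        rw [mem_degreeLT, ← hm, ← degree_eq_natDegree hT.ne_zero]
        exact degree_modByMonic_lt _ hT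
      refine ⟨⟨_, hlt⟩, ?_⟩
      rw [hψ]
      have h1 := modByMonic_add_div (X ^ (i : ℕ)) T
      have h2 := congrArg (fun f => aeval s f α) h1
      simp only [map_add, LinearMap.add_apply, map_pow, aeval_X] at h2
      rw [aeval_kill s (Dvd.intro _ rfl) hα, add_zero] at h2
      exact h2
    · rintro _ ⟨h, rfl⟩
      rw [hψ]
      have hdeg := mem_degreeLT.1 h.2
      by_cases h0 : (h : F[X]) = 0
      · rw [h0]; simp
      rw [aeval_eq_sum_range, LinearMap.sum_apply]
      apply Submodule.sum_mem
      intro i hi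
      rw [LinearMap.smul_apply]
      apply Submodule.smul_mem
      apply Submodule.subset_span
      rw [degree_eq_natDegree h0] at hdeg
      have hdeg : (h : F[X]).natDegree < m := by exact_mod_cast hdeg
      exact ⟨⟨i, by rw [Finset.mem_range] at hi; omega⟩, rfl⟩
  rw [hr, LinearMap.finrank_range_of_inj hinj, (degreeLTEquiv F m).finrank_eq]
  simp
end

lemma card_VV_ge {F K : Type} [Field F] [Fintype F] [Field K] [Fintype K] [Algebra F K] {T : F[X]}
    (hmin : (X - 1) * T = minpoly F (frb F K)) :
    Fintype.card F ^ (Module.finrank F K - 1) ≤ Nat.card (VV (frb F K) T) := by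
  classical
  set s := frb F K with hs
  have hle : LinearMap.range (aeval s T) ≤ LinearMap.ker (aeval s (X - 1 : F[X])) := by
    rintro _ ⟨x, rfl⟩
    rw [LinearMap.mem_ker, ← Module.End.mul_apply, ← map_mul, hmin, minpoly.aeval]
    rfl
  have hk : Module.finrank F (LinearMap.ker (aeval s (X - 1 : F[X]))) ≤ 1 := by
    have h1 : Nat.card (LinearMap.ker (aeval s (X - 1 : F[X]))) ≤ Fintype.card F := by
      have h2 := card_le_degree_of_subset_roots (R := K) (p := X ^ Fintype.card F - X)
        (Z := Finset.univ.filter fun x => x ∈ LinearMap.ker (aeval s (X - 1 : F[X]))) (by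
          intro x hx
          have hx : x ∈ LinearMap.ker (aeval s (X - 1 : F[X])) := by simpa using hx
          rw [mem_roots (FiniteField.X_pow_card_sub_X_ne_zero K Fintype.one_lt_card)]
          rw [LinearMap.mem_ker, map_sub, aeval_X, map_one, LinearMap.sub_apply] at hx
          simpa [hs] using hx)
      rw [FiniteField.X_pow_card_sub_X_natDegree_eq K Fintype.one_lt_card] at h2
      rw [Nat.card_eq_fintype_card, Fintype.card_subtype]
      exact h2
    rw [Module.natCard_eq_pow_finrank (K := F), Nat.card_eq_fintype_card] at h1
    exact (Nat.pow_le_pow_iff_right Fintype.one_lt_card).1 (by rwa [pow_one])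
  have h3 := LinearMap.finrank_range_add_finrank_ker (aeval s T)
  have h4 := Submodule.finrank_mono hle
  change _ ≤ Nat.card (LinearMap.ker (aeval s T))
  rw [Module.natCard_eq_pow_finrank (K := F), Nat.card_eq_fintype_card]
  apply Nat.pow_le_pow_right Fintype.card_pos
  omega

/-- Sieve criterion: if `p ∤ n`, `n ≥ 2`, `T = (xⁿ-1)/(x-1)` and
`W(T)·W(qⁿ-1) < q^(n/2 - 1)`, then there is a primitive `1`-normal element of `F_{qⁿ}`
over `F_q`. -/
theorem stmt_6 (p e q n : ℕ) (hp : p.Prime) (he : 0 < e) (hq : q = p ^ e)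
    (hn : 2 ≤ n) (hpn : ¬ p ∣ n)
    (F K : Type) [Field F] [Fintype F] [Field K] [Fintype K] [Algebra F K]
    (hcF : Fintype.card F = q) (hrK : Module.finrank F K = n)
    (hsieve : (Wpoly ((X ^ n - 1 : F[X]) /ₘ (X - 1)) : ℝ) * (Wint (q ^ n - 1) : ℝ) <
      (q : ℝ) ^ ((n : ℝ) / 2 - 1)) :
    ∃ α : K, IsPrimitiveElt α ∧ IskNormal q n 1 F α := by
  classical
  set T := (X ^ n - 1 : F[X]) /ₘ (X - 1) with hTdef
  have hX1 : (X - 1 : F[X]) = X - C 1 := by simp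
  have hXT : (X - 1) * T = X ^ n - 1 := by
    rw [hTdef, hX1, mul_divByMonic_eq_iff_isRoot]
    simp
  have hmonX : (X ^ n - 1 : F[X]).Monic := monic_X_pow_sub_C 1 (by omega)
  have hmon1 : (X - 1 : F[X]).Monic := by rw [hX1]; exact monic_X_sub_C 1
  have hTm : T.Monic := hmon1.of_mul_monic_left (by rw [hXT]; exact hmonX)
  have hT0 := hTm.ne_zero
  have hTd : T.natDegree = n - 1 := by
    have := congrArg natDegree hXT
    rw [hmon1.natDegree_mul hTm, hX1, natDegree_X_sub_C] at this
    have h2 : (X ^ n - 1 : F[X]).natDegree = n := by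
      rw [← C_1]; exact natDegree_X_pow_sub_C
    omega
  have hmin : (X - 1) * T = minpoly F (frb F K) := by
    rw [hXT, FiniteField.minpoly_frobeniusAlgHom, hrK]
  have hnF : (n : F) ≠ 0 := by
    have : Fact p.Prime := ⟨hp⟩
    have : CharP F p := by
      obtain ⟨p', hp'⟩ := CharP.exists F
      obtain ⟨m, hp'p, hm⟩ := FiniteField.card F p'
      rw [hcF, hq] at hm
      have : p ∣ p' ^ (m : ℕ) := by rw [← hm]; exact dvd_pow_self p he.ne'
      have := (Nat.prime_dvd_prime_iff_eq hp hp'p).1 (hp.dvd_of_dvd_pow this)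
      rwa [this]
    rw [Ne, CharP.cast_eq_zero_iff F p]
    exact hpn
  have hsq : Squarefree T :=
    (X_pow_sub_one_separable_iff.2 hnF).squarefree.squarefree_of_dvd (Dvd.intro_left _ hXT)
  have hex : ∀ P : irrF T, ∃ Q, T = P * Q := fun P => ((mem_irrF hT0).1 P.2).2.2
  choose Q hQ using hex
  have hcK : Fintype.card K = q ^ n := by
    rw [Module.card_eq_pow_finrank (K := F), hcF, hrK]
  have hcU : Nat.card Kˣ = q ^ n - 1 := by
    rw [Nat.card_units, Nat.card_eq_fintype_card, hcK]
  have hV := card_VV_ge hmin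
  rw [hcF, hrK] at hV
  have hW1 := Wpoly_ge hT0
  have hW2 := Wint_ge (N := Nat.card Kˣ) Nat.card_pos.ne'
  have hq0 : (0 : ℝ) < q := by
    rw [← hcF]; exact_mod_cast Fintype.card_pos
  have hineq : (2 : ℝ) ^ Fintype.card (irrF T) * 2 ^ Fintype.card (Nat.card Kˣ).primeFactors *
      Real.sqrt (Fintype.card K) < Nat.card (VV (frb F K) T) := by
    rw [Fintype.card_coe, Fintype.card_coe]
    have hW1' : (2 : ℝ) ^ (irrF T).card ≤ Wpoly T := by exact_mod_cast hW1
    have hW2' : (2 : ℝ) ^ (Nat.card Kˣ).primeFactors.card ≤ Wint (q ^ n - 1) := by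
      rw [← hcU]; exact_mod_cast hW2
    have hV' : (q : ℝ) ^ (n - 1) ≤ Nat.card (VV (frb F K) T) := by exact_mod_cast hV
    have hs : Real.sqrt (Fintype.card K) = (q : ℝ) ^ ((n : ℝ) / 2) := by
      rw [hcK, Nat.cast_pow, Real.sqrt_eq_rpow, ← Real.rpow_natCast, ← Real.rpow_mul hq0.le]
      congr 1
      ring
    have hsp : 0 < Real.sqrt (Fintype.card K) := by rw [hs]; positivity
    have hprod : (q : ℝ) ^ ((n : ℝ) / 2 - 1) * Real.sqrt (Fintype.card K) = (q : ℝ) ^ (n - 1) := by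
      rw [hs, ← Real.rpow_add hq0, ← Real.rpow_natCast]
      congr 1
      rw [Nat.cast_sub (by omega)]
      push_cast
      ring
    calc _ ≤ (Wpoly T : ℝ) * (Wint (q ^ n - 1) : ℝ) * Real.sqrt (Fintype.card K) := by gcongr
      _ < (q : ℝ) ^ ((n : ℝ) / 2 - 1) * Real.sqrt (Fintype.card K) := by gcongr
      _ = (q : ℝ) ^ (n - 1) := hprod
      _ ≤ _ := hV'
  obtain ⟨u, hu, hu1, hu2⟩ := combine (VV (frb F K) T)
    (fun P : irrF T => (VV (frb F K) (Q P)).addSubgroupOf (VV (frb F K) T))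
    (fun P => HH_ne_top _ hT0 hmin ((mem_irrF hT0).1 P.2).1 (hQ P))
    (HH_ind _ hT0 hsq Q hQ)
    (fun l : (Nat.card Kˣ).primeFactors => powSub K (l : ℕ))
    (fun l => powSub_ne_top (Nat.prime_of_mem_primeFactors l.2) (Nat.dvd_of_mem_primeFactors l.2))
    (powSub_ind (Nat.card Kˣ)) hineq
  refine ⟨u, primitive_of u fun l hl => hu2 ⟨l, hl⟩, ?_⟩
  have hfin := finrank_of_free (frb F K) hTm hTd (Nat.sub_le n 1) hu
    (fun h hh => dvd_of_free (frb F K) hT0 Q hQ hu (fun P hP => hu1 P hP) hh)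
  have hfun : (fun i : Fin n => ((frb F K) ^ (i : ℕ)) (u : K)) =
      fun i : Fin n => (u : K) ^ q ^ (i : ℕ) := by
    funext i
    rw [← hcF]
    exact frb_pow _ _
  rw [hfun] at hfin
  exact hfin

end
end

section
/- For every odd integer n ≥ 3, there exists a primitive 1-normal element of F_{2^n} over F_2. -/
open Polynomial

noncomputable section

lemma char_corr {K : Type} [Field K] [Fintype K] (χ : MulChar K ℂ) (hχ : χ ≠ 1) (c : K)
    (hc : c ≠ 0) : ∑ x, χ x * χ⁻¹ (x + c) = -1 := by
  classical
  have h1 : ∀ x, χ x * χ⁻¹ (x + c) = χ (1 - c * (x + c)⁻¹) - if x = -c then 1 else 0 := by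
    intro x
    by_cases hx : x = -c
    · subst hx; simp [MulChar.map_zero]
    · have hx' : x + c ≠ 0 := fun h => hx (eq_neg_of_add_eq_zero_left h)
      rw [if_neg hx, MulChar.inv_apply', ← map_mul, sub_zero]
      congr 1; field_simp; ring
  rw [Finset.sum_congr rfl (fun x _ => h1 x), Finset.sum_sub_distrib]
  have hb : Function.Bijective (fun x : K => 1 - c * (x + c)⁻¹) := by
    refine Finite.injective_iff_bijective.mp ?_
    intro x y h
    simp only [sub_right_inj, mul_right_inj' hc, inv_inj, add_left_inj] at h
    exact h
  rw [Function.Bijective.sum_comp hb (fun y => χ y), MulChar.sum_eq_zero_of_ne_one hχ]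
  simp

lemma char_subgroup {K : Type} [Field K] [Fintype K] [DecidableEq K] (χ : MulChar K ℂ) (hχ : χ ≠ 1)
    (V : Finset K) (h0 : 0 ∈ V) (hadd : ∀ x ∈ V, ∀ y ∈ V, x + y ∈ V) :
    ‖∑ v ∈ V, χ v‖ ≤ √(Fintype.card K : ℝ) := by
  set q : ℝ := (Fintype.card K : ℝ)
  set T : K → ℂ := fun x => ∑ v ∈ V, χ (x + v) with hT
  have hpos : (0:ℝ) < V.card := by exact_mod_cast Finset.card_pos.mpr ⟨0, h0⟩
  have hc : ∀ x ∈ V, T x = ∑ v ∈ V, χ v := by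
    intro x hx
    have hi : Set.InjOn (fun v => x + v) (V : Set K) := fun a _ b _ h => by simpa using h
    have him : V.image (fun v => x + v) = V := by
      apply Finset.eq_of_subset_of_card_le
      · intro y hy
        obtain ⟨v, hv, rfl⟩ := Finset.mem_image.mp hy
        exact hadd x hx v hv
      · rw [Finset.card_image_of_injOn hi]
    calc T x = ∑ v ∈ V.image (fun v => x + v), χ v := by rw [Finset.sum_image hi]
      _ = _ := by rw [him]
  have hcorr : ∀ v ∈ V, ∀ w ∈ V, ∑ x, χ (x + v) * χ⁻¹ (x + w) = if v = w then (q:ℂ) - 1 else -1 := by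
    intro v _ w _
    have hb : Function.Bijective (fun x : K => x + v) := (Equiv.addRight v).bijective
    have := Function.Bijective.sum_comp hb (fun x => χ x * χ⁻¹ (x + (w - v)))
    simp only [add_assoc, add_sub_cancel] at this
    rw [this]
    split_ifs with h
    · subst h
      have : ∀ x, χ x * χ⁻¹ (x + (v - v)) = 1 - if x = 0 then (1:ℂ) else 0 := by
        intro x
        by_cases hx : x = 0
        · subst hx; simp [MulChar.map_zero]
        · rw [if_neg hx, sub_self, add_zero, MulChar.inv_apply', ← map_mul, mul_inv_cancel₀ hx]; simp
      rw [Finset.sum_congr rfl (fun x _ => this x)]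
      simp [q]
    · exact char_corr χ hχ _ (sub_ne_zero.mpr (Ne.symm h))
  have hsumC : ∑ x, T x * star (T x) = (V.card : ℂ) * (q - V.card) := by
    have : ∀ x, T x * star (T x) = ∑ v ∈ V, ∑ w ∈ V, χ (x + v) * χ⁻¹ (x + w) := by
      intro x
      simp only [hT, star_sum, MulChar.star_apply', Finset.sum_mul_sum]
    rw [Finset.sum_congr rfl (fun x _ => this x), Finset.sum_comm]
    rw [Finset.sum_congr rfl (fun v _ => Finset.sum_comm)]
    rw [Finset.sum_congr rfl (fun v hv => Finset.sum_congr rfl (fun w hw => hcorr v hv w hw))]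
    have : ∀ v w : K, (if v = w then (q:ℂ) - 1 else -1) = (if v = w then (q:ℂ) else 0) - 1 := by
      intro v w; split_ifs <;> simp
    simp only [this, Finset.sum_sub_distrib, Finset.sum_ite_eq]
    simp [Finset.sum_ite_mem]
    ring
  have hsum : ∑ x, ‖T x‖ ^ 2 = V.card * (q - V.card) := by
    have h2 : ∀ x, T x * star (T x) = ((‖T x‖ ^ 2 : ℝ) : ℂ) := by
      intro x; simp [Complex.mul_conj, Complex.normSq_eq_norm_sq]
    simp only [h2] at hsumC
    exact_mod_cast hsumC
  have hle : ∑ x ∈ V, ‖T x‖ ^ 2 ≤ ∑ x, ‖T x‖ ^ 2 :=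
    Finset.sum_le_sum_of_subset_of_nonneg (Finset.subset_univ _) (fun _ _ _ => by positivity)
  rw [hsum, Finset.sum_congr rfl (fun x hx => by rw [hc x hx]), Finset.sum_const, nsmul_eq_mul] at hle
  have := le_of_mul_le_mul_left hle hpos
  apply Real.le_sqrt_of_sq_le
  linarith

open Classical in
lemma sieve_aux {K : Type} [Field K] [Fintype K] (B : Finset K) (hB0 : 0 ∉ B)
    (M : ℝ) (hM : ∀ η : MulChar K ℂ, η ≠ 1 → ‖∑ α ∈ B, η α‖ ≤ M)
    (c : ℕ → MulChar K ℂ) (S : Finset ℕ) (hS : ∀ p ∈ S, p.Prime ∧ orderOf (c p) = p) :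
    (∀ η : MulChar K ℂ, (∀ p ∈ S, ¬ p ∣ orderOf η) → η ≠ 1 →
      ‖∑ α ∈ B.filter (fun α => ∀ p ∈ S, c p α ≠ 1), η α‖ ≤ (∏ p ∈ S, (1 - 1 / (p:ℝ))) * (2 ^ S.card * M))
    ∧ (∏ p ∈ S, (1 - 1 / (p:ℝ))) * (B.card - (2 ^ S.card - 1) * M)
      ≤ ((B.filter (fun α => ∀ p ∈ S, c p α ≠ 1)).card : ℝ) := by
  induction S using Finset.induction_on with
  | empty => simpa using hM
  | insert p S hp ih =>
    have ih := ih (fun r hr => hS r (Finset.mem_insert_of_mem hr))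
    obtain ⟨hpp, hpo⟩ := hS p (Finset.mem_insert_self _ _)
    have hp0 : (0:ℝ) < p := by exact_mod_cast hpp.pos
    have hp1 : (1:ℝ) ≤ p := by exact_mod_cast hpp.one_le
    set θ := ∏ r ∈ S, (1 - 1 / (r:ℝ)) with hθ
    set A := B.filter (fun α => ∀ r ∈ S, c r α ≠ 1) with hA
    have hA0 : ∀ α ∈ A, α ≠ 0 := by
      rintro α hα rfl
      exact hB0 (Finset.mem_filter.mp hα).1
    -- key identity
    have key : ∀ η : MulChar K ℂ,
        ∑ α ∈ B.filter (fun α => ∀ r ∈ insert p S, c r α ≠ 1), η α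
          = (1 - 1 / (p:ℂ)) * ∑ α ∈ A, η α
            - (1 / (p:ℂ)) * ∑ j ∈ Finset.Ico 1 p, ∑ α ∈ A, (η * c p ^ j) α := by
      intro η
      have e1 : B.filter (fun α => ∀ r ∈ insert p S, c r α ≠ 1) = A.filter (fun α => c p α ≠ 1) := by
        ext α
        simp only [hA, Finset.mem_filter, Finset.mem_insert, forall_eq_or_imp]
        tauto
      rw [e1, Finset.sum_filter, Finset.sum_comm, Finset.mul_sum, Finset.mul_sum,
        ← Finset.sum_sub_distrib]
      refine Finset.sum_congr rfl (fun α hα => ?_)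
      have hα0 := hA0 α hα
      have hz : (c p α) ^ p = 1 := by
        rw [← MulChar.pow_apply' _ hpp.ne_zero]
        nth_rewrite 2 [← hpo]
        rw [pow_orderOf_eq_one, MulChar.one_apply (isUnit_iff_ne_zero.mpr hα0)]
      have hj : ∑ j ∈ Finset.Ico 1 p, (η * c p ^ j) α = η α * ∑ j ∈ Finset.Ico 1 p, (c p α) ^ j := by
        rw [Finset.mul_sum]
        refine Finset.sum_congr rfl (fun j hj => ?_)
        rw [MulChar.mul_apply, MulChar.pow_apply' _ (by have := Finset.mem_Ico.mp hj; omega)]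
      have hr : ∑ j ∈ Finset.range p, (c p α) ^ j = 1 + ∑ j ∈ Finset.Ico 1 p, (c p α) ^ j := by
        rw [Finset.range_eq_Ico, Finset.sum_eq_sum_Ico_succ_bot hpp.pos]; simp
      have hpc : (p:ℂ) ≠ 0 := by exact_mod_cast hpp.ne_zero
      rw [hj]
      by_cases h : c p α = 1
      · simp only [h, one_pow, Finset.sum_const, Nat.card_Ico, nsmul_eq_mul, ne_eq, not_true_eq_false, if_false]
        rw [Nat.cast_sub hpp.one_le]
        field_simp; push_cast; ring
      · have hg : ∑ j ∈ Finset.range p, (c p α) ^ j = 0 := by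
          have := mul_neg_geom_sum (c p α) p
          rw [hz, sub_self] at this
          exact (mul_eq_zero.mp this).resolve_left (sub_ne_zero.mpr (Ne.symm h))
        rw [hg] at hr
        have : ∑ j ∈ Finset.Ico 1 p, (c p α) ^ j = -1 := by linear_combination -hr
        rw [this]
        simp [h]; ring
    have hne : ∀ η : MulChar K ℂ, (¬ p ∣ orderOf η) → ∀ j ∈ Finset.Ico 1 p, η * c p ^ j ≠ 1 := by
      intro η hη j hj h
      have hj := Finset.mem_Ico.mp hj
      have h1 : orderOf (c p ^ j) = p := by
        rw [orderOf_pow, hpo, Nat.Coprime.gcd_eq_one, Nat.div_one]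
        exact (Nat.Prime.coprime_iff_not_dvd hpp).mpr (fun hd => by have := Nat.le_of_dvd (by omega) hd; omega)
      have h2 : c p ^ j = η⁻¹ := (inv_eq_of_mul_eq_one_right h).symm
      rw [h2, orderOf_inv] at h1
      exact hη (by rw [h1])
    have hord : ∀ η : MulChar K ℂ, (∀ r ∈ S, ¬ r ∣ orderOf η) → ∀ j, ∀ r ∈ S,
        ¬ r ∣ orderOf (η * c p ^ j) := by
      intro η hη j r hr hd
      have hrp := (hS r (Finset.mem_insert_of_mem hr)).1
      have h1 : orderOf (η * c p ^ j) ∣ orderOf η * p := by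
        apply orderOf_dvd_of_pow_eq_one
        rw [mul_pow, pow_mul, pow_orderOf_eq_one, one_pow, one_mul, ← pow_mul]
        rw [← mul_assoc, mul_comm, pow_mul]
        have : c p ^ p = 1 := by
          have := pow_orderOf_eq_one (c p)
          rwa [hpo] at this
        rw [this, one_pow]
      rcases (Nat.Prime.dvd_mul hrp).mp (hd.trans h1) with h | h
      · exact hη r hr h
      · rw [(Nat.prime_dvd_prime_iff_eq hrp hpp).mp h] at hr
        exact hp hr
    have herr : ∀ η : MulChar K ℂ, (∀ r ∈ S, ¬ r ∣ orderOf η) → (¬ p ∣ orderOf η) →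
        ‖(1 / (p:ℂ)) * ∑ j ∈ Finset.Ico 1 p, ∑ α ∈ A, (η * c p ^ j) α‖
          ≤ (1 - 1 / (p:ℝ)) * (θ * (2 ^ S.card * M)) := by
      intro η h1 h2
      rw [norm_mul]
      have : ‖∑ j ∈ Finset.Ico 1 p, ∑ α ∈ A, (η * c p ^ j) α‖ ≤
          ∑ j ∈ Finset.Ico 1 p, θ * (2 ^ S.card * M) :=
        norm_sum_le_of_le _ (fun j hj => ih.1 _ (hord η h1 j) (hne η h2 j hj))
      rw [Finset.sum_const, Nat.card_Ico, nsmul_eq_mul, Nat.cast_sub hpp.one_le] at this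
      have hn : ‖(1 / (p:ℂ))‖ = 1 / (p:ℝ) := by simp
      rw [hn]
      calc _ ≤ 1 / (p:ℝ) * (((p:ℝ) - (1:ℕ)) * (θ * (2 ^ S.card * M))) := by gcongr
        _ = _ := by field_simp; push_cast; ring
    have h1p : (0:ℝ) ≤ 1 - 1 / (p:ℝ) := by
      rw [sub_nonneg, div_le_one hp0]; exact hp1
    rw [Finset.prod_insert hp, Finset.card_insert_of_notMem hp]
    constructor
    · intro η hη hη1
      rw [key η]
      have hS' : ∀ r ∈ S, ¬ r ∣ orderOf η := fun r hr => hη r (Finset.mem_insert_of_mem hr)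
      have e1 := ih.1 η hS' hη1
      have e2 := herr η hS' (hη p (Finset.mem_insert_self _ _))
      have e3 : ‖(1 - 1 / (p:ℂ)) * ∑ α ∈ A, η α‖ ≤ (1 - 1 / (p:ℝ)) * (θ * (2 ^ S.card * M)) := by
        rw [norm_mul]
        have : ‖(1 - 1 / (p:ℂ))‖ = 1 - 1 / (p:ℝ) := by
          have : (1 - 1 / (p:ℂ)) = ((1 - 1 / (p:ℝ) : ℝ) : ℂ) := by push_cast; rfl
          rw [this, Complex.norm_real, Real.norm_of_nonneg h1p]
        rw [this]
        gcongr
      refine (norm_sub_le _ _).trans ((add_le_add e3 e2).trans (le_of_eq ?_))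
      rw [pow_succ]; ring
    · have hone : ∀ r ∈ insert p S, ¬ r ∣ orderOf (1 : MulChar K ℂ) := by
        intro r hr
        rw [orderOf_one, Nat.dvd_one]
        exact (hS r hr).1.one_lt.ne'
      have k1 := key 1
      have e2 := herr 1 (fun r hr => hone r (Finset.mem_insert_of_mem hr)) (hone p (Finset.mem_insert_self _ _))
      have hs : ∀ D : Finset K, (∀ α ∈ D, α ≠ 0) → ∑ α ∈ D, (1 : MulChar K ℂ) α = D.card := by
        intro D hD
        rw [Finset.sum_congr rfl (fun α hα => MulChar.one_apply (isUnit_iff_ne_zero.mpr (hD α hα)))]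
        simp
      rw [hs A hA0, hs _ (by rintro α hα rfl; exact hB0 (Finset.mem_filter.mp hα).1)] at k1
      set X := (1 / (p:ℂ)) * ∑ j ∈ Finset.Ico 1 p, ∑ α ∈ A, (1 * c p ^ j) α
      set D := (B.filter (fun α => ∀ r ∈ insert p S, c r α ≠ 1)).card
      have k2 : (D:ℝ) = (1 - 1 / (p:ℝ)) * A.card - X.re := by
        have := congrArg Complex.re k1
        have h3 : (1 - 1 / (p:ℂ)) * (A.card : ℂ) = (((1 - 1 / (p:ℝ)) * A.card : ℝ) : ℂ) := by push_cast; rfl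
        rw [h3, Complex.sub_re, Complex.ofReal_re, Complex.natCast_re] at this
        exact this
      have k3 : X.re ≤ (1 - 1 / (p:ℝ)) * (θ * (2 ^ S.card * M)) := (Complex.re_le_norm X).trans e2
      have k4 := mul_le_mul_of_nonneg_left ih.2 h1p
      rw [k2]
      calc _ = (1 - 1 / (p:ℝ)) * (θ * (B.card - (2 ^ S.card - 1) * M)) - (1 - 1 / (p:ℝ)) * (θ * (2 ^ S.card * M)) := by
            rw [pow_succ]; ring
        _ ≤ _ := by linarith

lemma prim_of_chars {K : Type} [Field K] [Fintype K] (c : ℕ → MulChar K ℂ)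
    (hc : ∀ p ∈ (Fintype.card K - 1).primeFactors, orderOf (c p) = p) (α : K) (hα : α ≠ 0)
    (h : ∀ p ∈ (Fintype.card K - 1).primeFactors, c p α ≠ 1) :
    ∀ b : K, b ≠ 0 → ∃ m : ℕ, α ^ m = b := by
  classical
  obtain ⟨g, hg⟩ := IsCyclic.exists_generator (α := Kˣ)
  have hcard : Nat.card Kˣ = Fintype.card K - 1 := by
    rw [Nat.card_eq_fintype_card, Fintype.card_units]
  have hog : orderOf g = Fintype.card K - 1 := by
    rw [orderOf_eq_card_of_forall_mem_zpowers hg, hcard]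
  set u : Kˣ := Units.mk0 α hα
  have hq0 : Fintype.card K - 1 ≠ 0 := by
    rw [← hcard]; exact Nat.card_pos.ne'
  obtain ⟨t, ht⟩ : ∃ t : ℕ, g ^ t = u := by
    have := hg u
    rw [mem_zpowers_iff_mem_range_orderOf] at this
    obtain ⟨t, -, ht⟩ := Finset.mem_image.mp this
    exact ⟨t, ht⟩
  have hcop : Nat.Coprime (Fintype.card K - 1) t := by
    by_contra hnc
    obtain ⟨p, hp, hp1, hp2⟩ := Nat.Prime.not_coprime_iff_dvd.mp hnc
    have hmem : p ∈ (Fintype.card K - 1).primeFactors := Nat.mem_primeFactors.mpr ⟨hp, hp1, hq0⟩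
    apply h p hmem
    obtain ⟨s, rfl⟩ := hp2
    have : α = ((g ^ s : Kˣ) : K) ^ p := by
      have h1 : α = (u : K) := rfl
      rw [h1, ← ht, mul_comm, pow_mul]; push_cast; ring
    rw [this, map_pow, ← MulChar.pow_apply_coe]
    nth_rewrite 2 [← hc p hmem]
    rw [pow_orderOf_eq_one, MulChar.one_apply_coe]
  have hou : orderOf u = Nat.card Kˣ := by
    rw [← ht, orderOf_pow, hog, hcop.gcd_eq_one, Nat.div_one, hcard]
  intro b hb
  have hmem : Units.mk0 b hb ∈ Subgroup.zpowers u := by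
    have : Subgroup.zpowers u = ⊤ := (Subgroup.card_eq_iff_eq_top _).mp (by rw [Nat.card_zpowers, hou])
    rw [this]; trivial
  rw [mem_zpowers_iff_mem_range_orderOf] at hmem
  obtain ⟨m, -, hm⟩ := Finset.mem_image.mp hmem
  refine ⟨m, ?_⟩
  have := congrArg Units.val hm
  simpa [u] using this

lemma exists_prim {K : Type} [Field K] [Fintype K] (B : Finset K) (hB0 : 0 ∉ B)
    (M : ℝ) (hM : ∀ η : MulChar K ℂ, η ≠ 1 → ‖∑ α ∈ B, η α‖ ≤ M)
    (hB : (2 ^ (Fintype.card K - 1).primeFactors.card - 1) * M < B.card) :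
    ∃ α ∈ B, ∀ b : K, b ≠ 0 → ∃ m : ℕ, α ^ m = b := by
  classical
  have hex : ∀ p, ∃ χ : MulChar K ℂ, p ∈ (Fintype.card K - 1).primeFactors → orderOf χ = p := by
    intro p
    by_cases hp : p ∈ (Fintype.card K - 1).primeFactors
    · obtain ⟨χ, hχ⟩ := MulChar.exists_mulChar_orderOf K (Nat.dvd_of_mem_primeFactors hp)
        (Complex.isPrimitiveRoot_exp p (Nat.prime_of_mem_primeFactors hp).ne_zero)
      exact ⟨χ, fun _ => hχ⟩
    · exact ⟨1, fun h => absurd h hp⟩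
  choose c hc using hex
  have := (sieve_aux B hB0 M hM c _ (fun p hp => ⟨Nat.prime_of_mem_primeFactors hp, hc p hp⟩)).2
  have hθ : 0 < ∏ p ∈ (Fintype.card K - 1).primeFactors, (1 - 1 / (p:ℝ)) := by
    apply Finset.prod_pos
    intro p hp
    have : (1:ℝ) < p := by exact_mod_cast (Nat.prime_of_mem_primeFactors hp).one_lt
    rw [sub_pos, div_lt_one (by linarith)]; exact this
  have h2 := lt_of_lt_of_le (mul_pos hθ (sub_pos.mpr hB)) this
  have h3 : 0 < _ := Nat.cast_pos.mp h2
  obtain ⟨α, hα⟩ := Finset.card_pos.mp h3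
  rw [Finset.mem_filter] at hα
  exact ⟨α, hα.1, prim_of_chars c hc α (fun h => hB0 (h ▸ hα.1)) hα.2⟩

/-- The Frobenius as a linear endomorphism. -/
def frobL (K : Type) [Field K] [Algebra (ZMod 2) K] : Module.End (ZMod 2) K :=
  (FiniteField.frobeniusAlgHom (ZMod 2) K).toLinearMap

lemma frobL_pow (K : Type) [Field K] [Algebra (ZMod 2) K] (i : ℕ) (α : K) :
    (frobL K ^ i) α = α ^ 2 ^ i := by
  induction i with
  | zero => simp
  | succ i ih =>
    rw [pow_succ', Module.End.mul_apply, ih]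
    simp [frobL, ZMod.card]
    ring

lemma aeval_frobL (K : Type) [Field K] [Algebra (ZMod 2) K] (p : (ZMod 2)[X]) (α : K) :
    aeval (frobL K) p α = ∑ i ∈ Finset.range (p.natDegree + 1), algebraMap (ZMod 2) K (p.coeff i) * α ^ 2 ^ i := by
  rw [aeval_eq_sum_range, LinearMap.sum_apply]
  refine Finset.sum_congr rfl (fun i _ => ?_)
  rw [LinearMap.smul_apply, frobL_pow, Algebra.smul_def]

lemma card_sub (K : Type) [Field K] [Fintype K] [Algebra (ZMod 2) K] (V : Submodule (ZMod 2) K) :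
    Nat.card V = 2 ^ Module.finrank (ZMod 2) V := by
  rw [Module.natCard_eq_pow_finrank (K := ZMod 2)]; simp

lemma ker_le (K : Type) [Field K] [Fintype K] [Algebra (ZMod 2) K] (p : (ZMod 2)[X]) (hp : p ≠ 0) :
    Module.finrank (ZMod 2) (LinearMap.ker (aeval (frobL K) p)) ≤ p.natDegree := by
  classical
  set P : K[X] := ∑ i ∈ Finset.range (p.natDegree + 1), C (algebraMap (ZMod 2) K (p.coeff i)) * X ^ 2 ^ i with hP
  have hc : P.coeff (2 ^ p.natDegree) = algebraMap (ZMod 2) K p.leadingCoeff := by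
    rw [hP, finsetSum_coeff, Finset.sum_eq_single p.natDegree]
    · simp
    · intro i hi hne
      rw [coeff_C_mul, coeff_X_pow, if_neg, mul_zero]
      intro h
      exact hne (Nat.pow_right_injective le_rfl h).symm
    · simp
  have hP0 : P ≠ 0 := by
    intro h
    rw [h, coeff_zero] at hc
    have := (map_eq_zero _).mp hc.symm
    exact hp (leadingCoeff_eq_zero.mp this)
  have hdeg : P.natDegree ≤ 2 ^ p.natDegree := by
    apply natDegree_sum_le_of_forall_le
    intro i hi
    refine (natDegree_C_mul_X_pow_le _ _).trans ?_
    exact Nat.pow_le_pow_right (by norm_num) (by simpa [Nat.lt_succ_iff] using hi)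
  have hsub : ((LinearMap.ker (aeval (frobL K) p) : Submodule (ZMod 2) K) : Set K) ⊆ (P.roots.toFinset : Set K) := by
    intro α hα
    have : aeval (frobL K) p α = 0 := hα
    rw [aeval_frobL] at this
    simp only [Finset.mem_coe, Multiset.mem_toFinset]
    rw [mem_roots hP0, IsRoot.def, hP, eval_finsetSum]
    simpa using this
  have h1 : Nat.card (LinearMap.ker (aeval (frobL K) p)) ≤ 2 ^ p.natDegree := by
    calc _ = Set.ncard ((LinearMap.ker (aeval (frobL K) p) : Submodule (ZMod 2) K) : Set K) := rfl
      _ ≤ (P.roots.toFinset : Set K).ncard := Set.ncard_le_ncard hsub (Finset.finite_toSet _)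
      _ = P.roots.toFinset.card := Set.ncard_coe_finset _
      _ ≤ _ := (Multiset.toFinset_card_le _).trans ((card_roots' P).trans hdeg)
  rw [card_sub] at h1
  exact (Nat.pow_le_pow_iff_right (by norm_num)).mp h1

lemma aeval_Xn (n : ℕ) (K : Type) [Field K] [Fintype K] [Algebra (ZMod 2) K]
    (hrK : Module.finrank (ZMod 2) K = n) : aeval (frobL K) (X ^ n - 1 : (ZMod 2)[X]) = 0 := by
  ext α
  have hc : Fintype.card K = 2 ^ n := by
    rw [Module.card_eq_pow_finrank (K := ZMod 2), hrK, ZMod.card]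
  simp [frobL_pow, ← hc, FiniteField.pow_card]

lemma ker_eq (n : ℕ) (hn : 0 < n) (K : Type) [Field K] [Fintype K] [Algebra (ZMod 2) K]
    (hrK : Module.finrank (ZMod 2) K = n) (g : (ZMod 2)[X]) (hg : g ∣ X ^ n - 1) :
    Module.finrank (ZMod 2) (LinearMap.ker (aeval (frobL K) g)) = g.natDegree := by
  obtain ⟨h, hh⟩ := hg
  have hm : (X ^ n - 1 : (ZMod 2)[X]).Monic := monic_X_pow_sub_C 1 hn.ne'
  have hg0 : g ≠ 0 := by rintro rfl; exact hm.ne_zero (by rw [hh, zero_mul])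
  have hh0 : h ≠ 0 := by rintro rfl; exact hm.ne_zero (by rw [hh, mul_zero])
  have hd : g.natDegree + h.natDegree = n := by
    rw [← natDegree_mul hg0 hh0, ← hh]
    exact natDegree_X_pow_sub_C (r := (1 : ZMod 2))
  have hr : LinearMap.range (aeval (frobL K) h) ≤ LinearMap.ker (aeval (frobL K) g) := by
    rintro _ ⟨α, rfl⟩
    rw [LinearMap.mem_ker, ← Module.End.mul_apply, ← map_mul, ← hh, aeval_Xn n K hrK]; rfl
  have h1 := Submodule.finrank_mono hr
  have h2 := LinearMap.finrank_range_add_finrank_ker (aeval (frobL K) h)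
  have h3 := ker_le K g hg0
  have h4 := ker_le K h hh0
  omega

open Classical in
/-- Elements killed by `h * ∏ S` but by none of the `h * ∏ (S \ g)`. -/
def Eset (K : Type) [Field K] [Fintype K] [Algebra (ZMod 2) K] (S : Finset (ZMod 2)[X])
    (h : (ZMod 2)[X]) : Finset K :=
  Finset.univ.filter (fun α => aeval (frobL K) (h * ∏ g ∈ S, g) α = 0 ∧
    ∀ g ∈ S, ∀ v, v * g = h * ∏ g ∈ S, g → aeval (frobL K) v α ≠ 0)

lemma mem_Eset {K : Type} [Field K] [Fintype K] [Algebra (ZMod 2) K] {S : Finset (ZMod 2)[X]}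
    {h : (ZMod 2)[X]} {α : K} : α ∈ Eset K S h ↔ aeval (frobL K) (h * ∏ g ∈ S, g) α = 0 ∧
    ∀ g ∈ S, ∀ v, v * g = h * ∏ g ∈ S, g → aeval (frobL K) v α ≠ 0 := by
  simp [Eset]

lemma aeval_mul_zero {K : Type} [Field K] [Algebra (ZMod 2) K] (a b : (ZMod 2)[X]) (α : K)
    (h : aeval (frobL K) b α = 0) : aeval (frobL K) (a * b) α = 0 := by
  rw [map_mul, Module.End.mul_apply, h, map_zero]

lemma Eset_rec {K : Type} [Field K] [Fintype K] [Algebra (ZMod 2) K] (S : Finset (ZMod 2)[X])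
    (g h : (ZMod 2)[X]) (hg : g ∉ S) (hS0 : ∀ s ∈ S, s ≠ 0) (hg0 : g ≠ 0)
    (hcop : ∀ s ∈ S, IsCoprime g s) {R : Type} [AddCommGroup R] (F : K → R) :
    ∑ α ∈ Eset K (insert g S) h, F α = ∑ α ∈ Eset K S (h * g), F α - ∑ α ∈ Eset K S h, F α := by
  classical
  have hsub : Eset K S h ⊆ Eset K S (h * g) := by
    intro α hα
    rw [mem_Eset] at hα ⊢
    refine ⟨?_, ?_⟩
    · have := aeval_mul_zero g _ α hα.1
      convert this using 2; ring_nf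
    · intro s hs w hw hw0
      have hv : (h * ∏ t ∈ S.erase s, t) * s = h * ∏ t ∈ S, t := by
        rw [mul_assoc, Finset.prod_erase_mul _ _ hs]
      apply hα.2 s hs _ hv
      set v := h * ∏ t ∈ S.erase s, t
      have hwv : w = g * v := by
        apply mul_right_cancel₀ (hS0 s hs)
        rw [hw, mul_assoc, mul_assoc g, hv]; ring
      obtain ⟨a, b, hab⟩ := hcop s hs
      have e1 : aeval (frobL K) (a * w + b * (v * s)) α = 0 := by
        rw [map_add, LinearMap.add_apply, aeval_mul_zero _ _ _ hw0, aeval_mul_zero _ _ _ (by rw [hv]; exact hα.1), add_zero]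
      have e2 : a * w + b * (v * s) = v := by
        rw [hwv]; linear_combination v * hab
      rwa [e2] at e1
  have heq : Eset K (insert g S) h = Eset K S (h * g) \ Eset K S h := by
    ext α
    have hpi : h * ∏ t ∈ insert g S, t = h * g * ∏ t ∈ S, t := by
      rw [Finset.prod_insert hg, mul_assoc]
    rw [Finset.mem_sdiff, mem_Eset, mem_Eset, hpi]
    constructor
    · rintro ⟨h1, h2⟩
      refine ⟨⟨h1, fun s hs => h2 s (Finset.mem_insert_of_mem hs)⟩, fun h3 => ?_⟩
      rw [mem_Eset] at h3
      exact h2 g (Finset.mem_insert_self _ _) (h * ∏ t ∈ S, t) (by ring) h3.1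
    · rintro ⟨⟨h1, h2⟩, h3⟩
      refine ⟨h1, fun s hs => ?_⟩
      rcases Finset.mem_insert.mp hs with rfl | hs
      · intro v hv hv0
        have : v = h * ∏ t ∈ S, t := by
          apply mul_right_cancel₀ hg0
          rw [hv]; ring
        apply h3
        rw [mem_Eset, ← this]
        refine ⟨hv0, fun r hr w hw hw0 => ?_⟩
        refine h2 r hr (s * w) ?_ (aeval_mul_zero _ _ _ hw0)
        rw [mul_assoc, hw, ← hv]; ring
      · exact h2 s hs
  rw [heq, Finset.sum_sdiff_eq_sub hsub]

lemma Eset_card (n : ℕ) (hn : 0 < n) (K : Type) [Field K] [Fintype K] [Algebra (ZMod 2) K]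
    (hrK : Module.finrank (ZMod 2) K = n) (S : Finset (ZMod 2)[X])
    (hS0 : ∀ s ∈ S, s ≠ 0) (hcop : ∀ s ∈ S, ∀ t ∈ S, s ≠ t → IsCoprime s t) :
    ∀ h : (ZMod 2)[X], h * ∏ g ∈ S, g ∣ X ^ n - 1 →
    ((Eset K S h).card : ℝ) = 2 ^ h.natDegree * ∏ g ∈ S, ((2:ℝ) ^ g.natDegree - 1) := by
  classical
  induction S using Finset.induction_on with
  | empty =>
    intro h hd
    simp only [Finset.prod_empty, mul_one] at hd ⊢
    have : (Eset K ∅ h).card = Nat.card (LinearMap.ker (aeval (frobL K) h)) := by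
      rw [Nat.card_eq_fintype_card, Fintype.card_subtype]
      congr 1
      ext α
      simp [mem_Eset]
    rw [this, card_sub, ker_eq n hn K hrK h hd]; simp
  | insert g S hg ih =>
    intro h hd
    have hg0 := hS0 g (Finset.mem_insert_self _ _)
    have hS0' : ∀ s ∈ S, s ≠ 0 := fun s hs => hS0 s (Finset.mem_insert_of_mem hs)
    have ih := ih hS0'
      (fun s hs t ht => hcop s (Finset.mem_insert_of_mem hs) t (Finset.mem_insert_of_mem ht))
    have key := Eset_rec (K := K) S g h hg hS0' hg0
      (fun s hs => hcop g (Finset.mem_insert_self _ _) s (Finset.mem_insert_of_mem hs)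
        (by rintro rfl; exact hg hs)) (fun _ => (1:ℝ))
    simp only [Finset.sum_const, nsmul_eq_mul, mul_one] at key
    rw [Finset.prod_insert hg, ← mul_assoc] at hd
    have hd2 : h * ∏ t ∈ S, t ∣ X ^ n - 1 := (Dvd.intro g (by ring)).trans hd
    have hh0 : h ≠ 0 := by
      rintro rfl
      have hm : (X ^ n - 1 : (ZMod 2)[X]).Monic := monic_X_pow_sub_C 1 hn.ne'
      exact hm.ne_zero (zero_dvd_iff.mp (by simpa using hd))
    rw [key, ih _ hd, ih _ hd2, Finset.prod_insert hg, natDegree_mul hh0 hg0, pow_add]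
    ring

lemma Eset_char (K : Type) [Field K] [Fintype K] [Algebra (ZMod 2) K]
    (χ : MulChar K ℂ) (M : ℝ)
    (hM : ∀ V : Submodule (ZMod 2) K, ∀ W : Finset K, (∀ x, x ∈ W ↔ x ∈ V) → ‖∑ v ∈ W, χ v‖ ≤ M)
    (S : Finset (ZMod 2)[X])
    (hS0 : ∀ s ∈ S, s ≠ 0) (hcop : ∀ s ∈ S, ∀ t ∈ S, s ≠ t → IsCoprime s t) :
    ∀ h : (ZMod 2)[X], ‖∑ α ∈ Eset K S h, χ α‖ ≤ 2 ^ S.card * M := by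
  classical
  induction S using Finset.induction_on with
  | empty =>
    intro h
    simpa using hM (LinearMap.ker (aeval (frobL K) h)) (Eset K ∅ h) (fun x => by simp [mem_Eset])
  | insert g S hg ih =>
    intro h
    have hg0 := hS0 g (Finset.mem_insert_self _ _)
    have hS0' : ∀ s ∈ S, s ≠ 0 := fun s hs => hS0 s (Finset.mem_insert_of_mem hs)
    have ih := ih hS0'
      (fun s hs t ht => hcop s (Finset.mem_insert_of_mem hs) t (Finset.mem_insert_of_mem ht))
    rw [Eset_rec (K := K) S g h hg hS0' hg0
      (fun s hs => hcop g (Finset.mem_insert_self _ _) s (Finset.mem_insert_of_mem hs)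
        (by rintro rfl; exact hg hs)) χ, Finset.card_insert_of_notMem hg, pow_succ]
    have := norm_sub_le (∑ α ∈ Eset K S (h * g), χ α) (∑ α ∈ Eset K S h, χ α)
    linarith [ih (h * g), ih h]

lemma coprime_of_monic_irr {g h : (ZMod 2)[X]} (hg : g.Monic) (hgi : Irreducible g)
    (hh : h.Monic) (hhi : Irreducible h) (hne : g ≠ h) : IsCoprime g h := by
  rcases (EuclideanDomain.dvd_or_coprime g h hgi) with hd | hc
  · exact absurd (eq_of_monic_of_associated hg hh (hgi.associated_of_dvd hhi hd)) hne
  · exact hc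

lemma exists_factors (n : ℕ) (hn : 3 ≤ n) (hodd : Odd n) :
    ∃ T : Finset (ZMod 2)[X], (X - 1) * ∏ g ∈ T, g = X ^ n - 1 ∧
      (∀ g ∈ T, g.Monic ∧ Irreducible g ∧ 2 ≤ g.natDegree) ∧
      (∀ s ∈ T, ∀ t ∈ T, s ≠ t → IsCoprime s t) ∧
      (∀ d, 1 ≤ d → d * (T.filter (fun g => g.natDegree = d)).card + 2 ≤ 2 ^ d) := by
  classical
  have hm : (X ^ n - 1 : (ZMod 2)[X]).Monic := monic_X_pow_sub_C 1 (by omega)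
  have hn1 : (n : ZMod 2) ≠ 0 := by
    rw [Ne, ZMod.natCast_eq_zero_iff]
    exact fun h => (Nat.not_even_iff_odd.mpr hodd) (even_iff_two_dvd.mpr h)
  have hsep : (X ^ n - 1 : (ZMod 2)[X]).Separable := X_pow_sub_one_separable_iff.mpr hn1
  have hnd := (UniqueFactorizationMonoid.squarefree_iff_nodup_normalizedFactors hm.ne_zero).mp hsep.squarefree
  set N := UniqueFactorizationMonoid.normalizedFactors (X ^ n - 1 : (ZMod 2)[X]) with hN
  have hmem : ∀ g ∈ N, g.Monic ∧ Irreducible g ∧ g ∣ X ^ n - 1 := by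
    intro g hg
    have hi := UniqueFactorizationMonoid.irreducible_of_normalized_factor g hg
    refine ⟨?_, hi, UniqueFactorizationMonoid.dvd_of_mem_normalizedFactors hg⟩
    have := UniqueFactorizationMonoid.normalize_normalized_factor g hg
    rw [← this]
    exact monic_normalize hi.ne_zero
  have hprod : ∏ g ∈ N.toFinset, g = X ^ n - 1 := by
    have h1 : ∏ g ∈ N.toFinset, g = N.prod := by
      rw [Finset.prod_eq_multiset_prod, Multiset.toFinset_val, Multiset.dedup_eq_self.mpr hnd, Multiset.map_id']
    apply eq_of_monic_of_associated _ hm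
    · rw [h1]; exact UniqueFactorizationMonoid.prod_normalizedFactors hm.ne_zero
    · exact monic_prod_of_monic _ _ (fun g hg => (hmem g (Multiset.mem_toFinset.mp hg)).1)
  have hX1m : (X - 1 : (ZMod 2)[X]).Monic := monic_X_sub_C 1
  have hX1i : Irreducible (X - 1 : (ZMod 2)[X]) := irreducible_X_sub_C 1
  have hX1 : (X - 1 : (ZMod 2)[X]) ∈ N.toFinset := by
    rw [Multiset.mem_toFinset]
    obtain ⟨q, hq, hq2⟩ := UniqueFactorizationMonoid.exists_mem_normalizedFactors_of_dvd hm.ne_zero hX1i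
      (sub_one_dvd_pow_sub_one (X : (ZMod 2)[X]) n)
    rwa [eq_of_monic_of_associated hX1m (hmem q hq).1 hq2]
  have hnX : ∀ g ∈ N, g ≠ X := by
    rintro g hg rfl
    have := (hmem _ hg).2.2
    rw [X_dvd_iff] at this
    simp [coeff_X_pow, show (0:ℕ) ≠ n by omega] at this
  have hT : ∀ g ∈ N.toFinset.erase (X - 1), g.Monic ∧ Irreducible g ∧ g ≠ X ∧ g ≠ X - 1 := by
    intro g hg
    rw [Finset.mem_erase, Multiset.mem_toFinset] at hg
    exact ⟨(hmem g hg.2).1, (hmem g hg.2).2.1, hnX g hg.2, hg.1⟩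
  refine ⟨N.toFinset.erase (X - 1), ?_, ?_, ?_, ?_⟩
  · rw [← hprod]; exact Finset.mul_prod_erase N.toFinset (fun g => g) hX1
  · intro g hg
    obtain ⟨h1, h2, h3, h4⟩ := hT g hg
    refine ⟨h1, h2, ?_⟩
    have := h2.natDegree_pos
    by_contra hlt
    have hd : g.natDegree = 1 := by omega
    have := h1.eq_X_add_C hd
    have h01 : ∀ a : ZMod 2, a = 0 ∨ a = -1 := by decide
    rcases h01 (g.coeff 0) with h | h
    · rw [h] at this; exact h3 (by simpa using this)
    · rw [h] at this; exact h4 (by rw [this, C_neg, sub_eq_add_neg, C_1])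
  · intro s hs t ht hne
    exact coprime_of_monic_irr (hT s hs).1 (hT s hs).2.1 (hT t ht).1 (hT t ht).2.1 hne
  · intro d hd
    set U := (N.toFinset.erase (X - 1)).filter (fun g => g.natDegree = d) with hU
    have hUT : ∀ g ∈ U, g.Monic ∧ Irreducible g ∧ g ≠ X ∧ g ≠ X - 1 :=
      fun g hg => hT g (Finset.mem_filter.mp hg).1
    have hXne : (X : (ZMod 2)[X]) ≠ X - 1 := by
      intro h
      have := congrArg (eval 0) h
      simp at this
    have h1 : (X - 1 : (ZMod 2)[X]) ∉ U := fun h => (hUT _ h).2.2.2 rfl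
    have h2 : (X : (ZMod 2)[X]) ∉ insert (X - 1) U := by
      intro h
      rcases Finset.mem_insert.mp h with h | h
      · exact hXne h
      · exact (hUT _ h).2.2.1 rfl
    have hall : ∀ g ∈ insert X (insert (X - 1) U), g.Monic ∧ Irreducible g ∧ g ∣ (X ^ 2 ^ d - X : (ZMod 2)[X]) := by
      intro g hg
      have hh : ∀ g : (ZMod 2)[X], Irreducible g → g.natDegree ∣ d → g ∣ (X ^ 2 ^ d - X : (ZMod 2)[X]) := by
        intro g hi hdv
        have := hi.natDegree_dvd_iff_dvd_X_pow_card_pow_sub_X.mp hdv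
        simpa using this
      rcases Finset.mem_insert.mp hg with rfl | hg
      · exact ⟨monic_X, irreducible_X, hh _ irreducible_X (by simp)⟩
      rcases Finset.mem_insert.mp hg with rfl | hg
      · exact ⟨hX1m, hX1i, hh _ hX1i (by rw [show (X - 1 : (ZMod 2)[X]) = X - C 1 by simp, natDegree_X_sub_C]; simp)⟩
      · exact ⟨(hUT g hg).1, (hUT g hg).2.1, hh _ (hUT g hg).2.1 (by rw [(Finset.mem_filter.mp hg).2])⟩
    have hdvd : ∏ g ∈ insert X (insert (X - 1) U), g ∣ (X ^ 2 ^ d - X : (ZMod 2)[X]) := by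
      apply Finset.prod_dvd_of_coprime
      · intro s hs t ht hne
        exact coprime_of_monic_irr (hall s hs).1 (hall s hs).2.1 (hall t ht).1 (hall t ht).2.1 hne
      · exact fun g hg => (hall g hg).2.2
    have hne0 := FiniteField.X_pow_card_pow_sub_X_ne_zero (ZMod 2) (n := d) (p := 2) (by omega) (by norm_num)
    have hX1d : (X - 1 : (ZMod 2)[X]).natDegree = 1 := by
      rw [show (X - 1 : (ZMod 2)[X]) = X - C 1 by simp, natDegree_X_sub_C]
    have hle := natDegree_le_of_dvd hdvd hne0
    rw [FiniteField.X_pow_card_pow_sub_X_natDegree_eq (ZMod 2) (n := d) (p := 2) (by omega) (by norm_num),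
      natDegree_prod_of_monic _ _ (fun g hg => (hall g hg).1), Finset.sum_insert h2, Finset.sum_insert h1,
      Finset.sum_congr rfl (fun g hg => (Finset.mem_filter.mp hg).2), Finset.sum_const,
      natDegree_X, hX1d, smul_eq_mul] at hle
    have hle' : 1 + (1 + U.card * d) ≤ 2 ^ d := hle
    rw [mul_comm]
    omega

lemma Eset_normal (n : ℕ) (hn : 3 ≤ n) (K : Type) [Field K] [Fintype K] [Algebra (ZMod 2) K]
    (hrK : Module.finrank (ZMod 2) K = n) (T : Finset (ZMod 2)[X])
    (hT : (X - 1) * ∏ g ∈ T, g = X ^ n - 1)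
    (hT2 : ∀ g ∈ T, g.Monic ∧ Irreducible g ∧ 2 ≤ g.natDegree) (α : K)
    (hα : α ∈ Eset K T 1) : IskNormal 2 n 1 (ZMod 2) α := by
  classical
  rw [mem_Eset, one_mul] at hα
  set f := ∏ g ∈ T, g with hf
  have hfm : f.Monic := monic_prod_of_monic _ _ (fun g hg => (hT2 g hg).1)
  have hX1m : (X - 1 : (ZMod 2)[X]).Monic := monic_X_sub_C 1
  have hfd : f.natDegree = n - 1 := by
    have h1 := congrArg natDegree hT
    rw [hX1m.natDegree_mul hfm, show (X ^ n - 1 : (ZMod 2)[X]) = X ^ n - C 1 by simp,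
      show (X - 1 : (ZMod 2)[X]) = X - C 1 by simp, natDegree_X_sub_C, natDegree_X_pow_sub_C] at h1
    omega
  -- anything killing `α` is a multiple of `f`
  have hann : ∀ p : (ZMod 2)[X], aeval (frobL K) p α = 0 → f ∣ p := by
    intro p hp
    set m := EuclideanDomain.gcd p f with hmdef
    have hm0 : aeval (frobL K) m α = 0 := by
      rw [hmdef, EuclideanDomain.gcd_eq_gcd_ab, map_add, LinearMap.add_apply, mul_comm p, mul_comm f,
        aeval_mul_zero _ _ _ hp, aeval_mul_zero _ _ _ hα.1, add_zero]
    obtain ⟨w, hw⟩ : m ∣ f := EuclideanDomain.gcd_dvd_right p f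
    have hmp : m ∣ p := EuclideanDomain.gcd_dvd_left p f
    by_cases hu : IsUnit w
    · obtain ⟨u, rfl⟩ := hu
      rw [hw]
      exact (Units.mul_right_dvd).mpr hmp
    · exfalso
      have hw0 : w ≠ 0 := by
        rintro rfl; exact hfm.ne_zero (by rw [hw, mul_zero])
      obtain ⟨i, hi, hiw⟩ := WfDvdMonoid.exists_irreducible_factor hu hw0
      have hif : i ∣ ∏ g ∈ T, g := by rw [← hf, hw]; exact hiw.mul_left m
      obtain ⟨g, hg, hig⟩ := (Prime.dvd_finsetProd_iff hi.prime _).mp hif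
      have hgw : g ∣ w := ((hi.associated_of_dvd (hT2 g hg).2.1 hig).symm.dvd).trans hiw
      obtain ⟨r, rfl⟩ := hgw
      refine hα.2 g hg (r * m) ?_ (aeval_mul_zero _ _ _ hm0)
      rw [hw]; ring
  have hspan_le : Submodule.span (ZMod 2) (Set.range fun i : Fin n => α ^ 2 ^ (i : ℕ)) ≤
      LinearMap.ker (aeval (frobL K) f) := by
    rw [Submodule.span_le]
    rintro _ ⟨i, rfl⟩
    simp only [SetLike.mem_coe, LinearMap.mem_ker]
    rw [← frobL_pow]
    have := aeval_mul_zero (X ^ (i:ℕ)) f α hα.1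
    rw [mul_comm, map_mul, Module.End.mul_apply, map_pow, aeval_X] at this
    exact this
  have hker := ker_eq n (by omega) K hrK f ⟨X - 1, by rw [mul_comm]; exact hT.symm⟩
  have hli : LinearIndependent (ZMod 2) (fun i : Fin (n - 1) => α ^ 2 ^ (i : ℕ)) := by
    rw [Fintype.linearIndependent_iff]
    intro c hc i
    set p : (ZMod 2)[X] := ∑ j : Fin (n - 1), C (c j) * X ^ (j : ℕ) with hp
    have hp0 : aeval (frobL K) p α = 0 := by
      rw [hp, map_sum, LinearMap.sum_apply, ← hc]
      refine Finset.sum_congr rfl (fun j _ => ?_)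
      rw [map_mul, map_pow, aeval_X, aeval_C, Module.End.mul_apply, frobL_pow]
      rfl
    have hdeg : p.degree < f.degree := by
      rw [degree_eq_natDegree hfm.ne_zero, hfd, hp]
      refine (degree_sum_fin_lt c)
    have hpz := eq_zero_of_dvd_of_degree_lt (hann p hp0) hdeg
    have hcf : p.coeff i = c i := by
      rw [hp, finsetSum_coeff, Finset.sum_eq_single i]
      · simp
      · intro j _ hj
        rw [coeff_C_mul, coeff_X_pow, if_neg, mul_zero]
        exact fun h => hj (Fin.ext h.symm)
      · simp
    rw [← hcf, hpz, coeff_zero]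
  have hle2 : Submodule.span (ZMod 2) (Set.range fun i : Fin (n - 1) => α ^ 2 ^ (i : ℕ)) ≤
      Submodule.span (ZMod 2) (Set.range fun i : Fin n => α ^ 2 ^ (i : ℕ)) := by
    apply Submodule.span_mono
    rintro _ ⟨i, rfl⟩
    exact ⟨⟨i, by omega⟩, rfl⟩
  have h1 := finrank_span_eq_card hli
  rw [Fintype.card_fin] at h1
  have h2 := Submodule.finrank_mono hle2
  have h3 := Submodule.finrank_mono hspan_le
  rw [hker, hfd] at h3
  unfold IskNormal
  omega

lemma prime_M31 : Nat.Prime 2147483647 := by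
  have := lucas_lehmer_sufficiency 31 (by norm_num) (by norm_num)
  rwa [show mersenne 31 = 2147483647 by norm_num [mersenne]] at this

lemma prime_big : Nat.Prime 616318177 := by
  apply lucas_primality _ (5 : ZMod 616318177)
  · norm_num only
    reduce_mod_char
  · intro q hq hd
    have hd' : q ∣ 2 ^ 5 * 3 * 37 * 167 * 1039 := by
      norm_num only
      norm_num only at hd
      exact hd
    have h : q = 2 ∨ q = 3 ∨ q = 37 ∨ q = 167 ∨ q = 1039 := by
      rw [hq.dvd_mul, hq.dvd_mul, hq.dvd_mul, hq.dvd_mul] at hd'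
      rcases hd' with (((h | h) | h) | h) | h
      · exact Or.inl ((Nat.prime_dvd_prime_iff_eq hq Nat.prime_two).mp (hq.dvd_of_dvd_pow h))
      · exact Or.inr (Or.inl ((Nat.prime_dvd_prime_iff_eq hq (by norm_num)).mp h))
      · exact Or.inr (Or.inr (Or.inl ((Nat.prime_dvd_prime_iff_eq hq (by norm_num)).mp h)))
      · exact Or.inr (Or.inr (Or.inr (Or.inl ((Nat.prime_dvd_prime_iff_eq hq (by norm_num)).mp h))))
      · exact Or.inr (Or.inr (Or.inr (Or.inr ((Nat.prime_dvd_prime_iff_eq hq (by norm_num)).mp h))))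
    rcases h with rfl | rfl | rfl | rfl | rfl <;> norm_num only <;> reduce_mod_char <;> decide

lemma prod_w (T : Finset (ZMod 2)[X]) (h2 : ∀ g ∈ T, 2 ≤ g.natDegree)
    (hc : ∀ d, 1 ≤ d → d * (T.filter (fun g => g.natDegree = d)).card + 2 ≤ 2 ^ d)
    (w : ℕ → ℝ) (hw0 : ∀ d ∈ Finset.Icc 2 5, 0 < w d) (hw1 : ∀ d ∈ Finset.Icc 2 5, w d ≤ 1)
    (hw : ∀ d, 6 ≤ d → 1 ≤ w d) :
    w 2 * w 3 ^ 2 * w 4 ^ 3 * w 5 ^ 6 ≤ ∏ g ∈ T, w g.natDegree := by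
  classical
  have h1 : ∏ g ∈ T, ∏ d ∈ Finset.Icc 2 5, (if g.natDegree = d then w d else 1) ≤ ∏ g ∈ T, w g.natDegree := by
    apply Finset.prod_le_prod
    · intro g _
      apply Finset.prod_nonneg
      intro d hd
      split_ifs
      · exact (hw0 d hd).le
      · norm_num
    · intro g hg
      rw [Finset.prod_ite_eq]
      split_ifs with h
      · exact le_rfl
      · rw [Finset.mem_Icc] at h
        exact hw _ (by have := h2 g hg; omega)
  refine le_trans ?_ h1
  rw [Finset.prod_comm]
  have h3 : ∀ d, ∏ g ∈ T, (if g.natDegree = d then w d else 1) = w d ^ (T.filter (fun g => g.natDegree = d)).card := by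
    intro d
    rw [← Finset.prod_filter, Finset.prod_const]
  simp only [h3]
  have h4 : ∀ d ∈ Finset.Icc 2 5, ∀ c, (T.filter (fun g => g.natDegree = d)).card ≤ c →
      w d ^ c ≤ w d ^ (T.filter (fun g => g.natDegree = d)).card :=
    fun d hd c h => pow_le_pow_of_le_one (hw0 d hd).le (hw1 d hd) h
  have a2 := h4 2 (by simp) 1 (by have := hc 2 (by norm_num); omega)
  have a3 := h4 3 (by simp) 2 (by have := hc 3 (by norm_num); omega)
  have a4 := h4 4 (by simp) 3 (by have := hc 4 (by norm_num); omega)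
  have a5 := h4 5 (by simp) 6 (by have := hc 5 (by norm_num); omega)
  have p2 := hw0 2 (by simp)
  have p3 := hw0 3 (by simp)
  have p4 := hw0 4 (by simp)
  have p5 := hw0 5 (by simp)
  rw [show Finset.Icc 2 5 = {2, 3, 4, 5} by decide]
  rw [Finset.prod_insert (by decide), Finset.prod_insert (by decide), Finset.prod_insert (by decide),
    Finset.prod_singleton, ← mul_assoc, ← mul_assoc]
  rw [pow_one] at a2
  gcongr

lemma excl (p a t n : ℕ) (hn : Odd n) (hp : p ∣ 2 ^ (2 ^ a * t) - 1) (h : p ∣ 2 ^ n - 1) :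
    p ∣ 2 ^ t - 1 := by
  have h1 := Nat.dvd_gcd h hp
  rw [Nat.pow_sub_one_gcd_pow_sub_one] at h1
  have hc : Nat.Coprime n (2 ^ a) := (Nat.Coprime.pow_right a (Nat.coprime_two_right.mpr hn))
  rw [Nat.Coprime.gcd_mul_left_cancel_right t hc.symm] at h1
  exact h1.trans (Nat.pow_sub_one_dvd_pow_sub_one 2 (Nat.gcd_dvd_right n t))

lemma small_primes (n p : ℕ) (hn : Odd n) (hpp : p.Prime) (h : p ∣ 2 ^ n - 1) (hlt : p < 64) :
    p ∈ ({7, 23, 31, 47} : Finset ℕ) := by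
  have hn0 : n ≠ 0 := by rintro rfl; simp at hn
  by_contra hmem
  have h2 : p ≠ 2 := by
    rintro rfl
    have : 2 ∣ 2 ^ n := dvd_pow_self 2 hn0
    have h1 : 1 ≤ 2 ^ n := Nat.one_le_two_pow
    omega
  interval_cases p <;> first
    | (exfalso; revert hpp; norm_num; done)
    | (exact hmem (by decide))
    | (exact h2 rfl)
    | exact absurd (excl 3 1 1 n hn (by norm_num) h) (by norm_num)
    | exact absurd (excl 5 2 1 n hn (by norm_num) h) (by norm_num)
    | exact absurd (excl 11 1 5 n hn (by norm_num) h) (by norm_num)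
    | exact absurd (excl 13 2 3 n hn (by norm_num) h) (by norm_num)
    | exact absurd (excl 17 4 1 n hn (by norm_num) h) (by norm_num)
    | exact absurd (excl 19 1 9 n hn (by norm_num) h) (by norm_num)
    | exact absurd (excl 29 2 7 n hn (by norm_num) h) (by norm_num)
    | exact absurd (excl 37 2 9 n hn (by norm_num) h) (by norm_num)
    | exact absurd (excl 41 3 5 n hn (by norm_num) h) (by norm_num)
    | exact absurd (excl 43 1 21 n hn (by norm_num) h) (by norm_num)
    | exact absurd (excl 53 2 13 n hn (by norm_num) h) (by norm_num)
    | exact absurd (excl 59 1 29 n hn (by norm_num) h) (by norm_num)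
    | exact absurd (excl 61 2 15 n hn (by norm_num) h) (by norm_num)

lemma omega_bound (n : ℕ) (hn : Odd n) :
    ((2:ℝ) ^ (2 ^ n - 1).primeFactors.card) ^ 6 * 234577 ≤ 2 ^ 24 * 2 ^ n := by
  classical
  have hn0 : n ≠ 0 := by rintro rfl; simp at hn
  set P := (2 ^ n - 1).primeFactors with hP
  set Q : Finset ℕ := {7, 23, 31, 47} with hQ
  have hm0 : 2 ^ n - 1 ≠ 0 := by
    have := Nat.one_lt_two_pow hn0
    omega
  have hQ1 : ∀ p ∈ Q, (0:ℝ) < (p:ℝ) / 64 ∧ (p:ℝ) / 64 ≤ 1 := by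
    intro p hp
    simp only [hQ, Finset.mem_insert, Finset.mem_singleton] at hp
    rcases hp with rfl | rfl | rfl | rfl <;> norm_num
  have h1 : ∏ p ∈ P, (if p ∈ Q then (p:ℝ) / 64 else 1) ≤ ∏ p ∈ P, ((p:ℝ) / 64) := by
    apply Finset.prod_le_prod
    · intro p _; split_ifs <;> positivity
    · intro p hp
      split_ifs with h
      · exact le_rfl
      · have hpp := Nat.prime_of_mem_primeFactors hp
        have : 64 ≤ p := by
          by_contra hlt
          exact h (small_primes n p hn hpp (Nat.dvd_of_mem_primeFactors hp) (by omega))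
        rw [one_le_div (by norm_num)]
        exact_mod_cast this
  have h2 : ∏ p ∈ Q, ((p:ℝ) / 64) ≤ ∏ p ∈ P, (if p ∈ Q then (p:ℝ) / 64 else 1) := by
    rw [← Finset.prod_filter, ← Finset.prod_filter_mul_prod_filter_not Q (fun p => p ∈ P)]
    have e : Q.filter (fun p => p ∈ P) = P.filter (fun p => p ∈ Q) := by
      ext p; simp only [Finset.mem_filter]; tauto
    rw [e]
    apply mul_le_of_le_one_right
    · exact Finset.prod_nonneg (fun p _ => by positivity)
    · apply Finset.prod_le_one
      · intro p _; positivity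
      · intro p hp; exact (hQ1 p (Finset.mem_filter.mp hp).1).2
  have h3 : ∏ p ∈ P, (p:ℝ) ≤ 2 ^ n := by
    have : ∏ p ∈ P, p ≤ 2 ^ n - 1 := Nat.le_of_dvd (Nat.pos_of_ne_zero hm0) (Nat.prod_primeFactors_dvd _)
    have h' : ∏ p ∈ P, p ≤ 2 ^ n := by omega
    have h'' := (Nat.cast_le (α := ℝ)).mpr h'
    push_cast at h''
    exact h''
  have h4 : ∏ p ∈ Q, ((p:ℝ) / 64) = 234577 / 2 ^ 24 := by
    rw [hQ, Finset.prod_insert (by decide), Finset.prod_insert (by decide), Finset.prod_insert (by decide),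
      Finset.prod_singleton]
    norm_num
  have h5 : ∏ p ∈ P, ((p:ℝ) / 64) = (∏ p ∈ P, (p:ℝ)) / 64 ^ P.card := by
    rw [Finset.prod_div_distrib, Finset.prod_const]
  have h6 := h2.trans h1
  rw [h4, h5, div_le_div_iff₀ (by positivity) (by positivity)] at h6
  have h7 : ((2:ℝ) ^ P.card) ^ 6 = 64 ^ P.card := by
    rw [← pow_mul, mul_comm, pow_mul]; norm_num
  rw [h7]
  nlinarith [h6, h3]

lemma big_ineq (b y w k : ℝ) (hb : 0 < b) (hy : 2 ^ 39 ≤ y) (hw : 0 < w) (hk : 0 < k)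
    (h1 : (3 ^ 5 / 2 ^ 13) * (7 ^ 5 / 2 ^ 17) ^ 2 * (15 ^ 5 / 2 ^ 21) ^ 3 * (31 ^ 5 / 2 ^ 25) ^ 6 * ((y / 2) ^ 4 * k ^ 5) ≤ b ^ 5)
    (h2 : w ^ 6 * 234577 ≤ 2 ^ 24 * y) : w * (k * √y) < b := by
  have hy0 : 0 < y := lt_of_lt_of_le (by norm_num) hy
  have hs : √y ^ 2 = y := Real.sq_sqrt hy0.le
  apply lt_of_pow_lt_pow_left₀ 30 hb.le
  set ρ : ℝ := (3 ^ 5 / 2 ^ 13) * (7 ^ 5 / 2 ^ 17) ^ 2 * (15 ^ 5 / 2 ^ 21) ^ 3 * (31 ^ 5 / 2 ^ 25) ^ 6 with hρ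
  have hρ0 : 0 < ρ := by rw [hρ]; positivity
  have e1 : (w * (k * √y)) ^ 30 = (w ^ 6) ^ 5 * (k ^ 30 * y ^ 15) := by
    calc _ = (w ^ 6) ^ 5 * (k ^ 30 * (√y ^ 2) ^ 15) := by ring
      _ = _ := by rw [hs]
  have e2 : w ^ 6 ≤ 2 ^ 24 / 234577 * y := by
    linarith
  have e3 : (ρ * ((y / 2) ^ 4 * k ^ 5)) ^ 6 ≤ b ^ 30 := by
    calc _ ≤ (b ^ 5) ^ 6 := by gcongr
      _ = _ := by ring
  have e4 : (2 ^ 24 / 234577) ^ 5 < ρ ^ 6 / 2 ^ 24 * y ^ 4 := by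
    calc ((2:ℝ) ^ 24 / 234577) ^ 5 < ρ ^ 6 / 2 ^ 24 * (2 ^ 39) ^ 4 := by rw [hρ]; norm_num
      _ ≤ _ := by gcongr
  rw [e1]
  calc (w ^ 6) ^ 5 * (k ^ 30 * y ^ 15) ≤ (2 ^ 24 / 234577 * y) ^ 5 * (k ^ 30 * y ^ 15) := by gcongr
    _ = (2 ^ 24 / 234577) ^ 5 * (k ^ 30 * y ^ 20) := by ring
    _ < ρ ^ 6 / 2 ^ 24 * y ^ 4 * (k ^ 30 * y ^ 20) := by gcongr
    _ = (ρ * ((y / 2) ^ 4 * k ^ 5)) ^ 6 := by ring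
    _ ≤ _ := e3

lemma small_ineq (b n r : ℕ) (x y : ℝ) (hx : (32 / 31 : ℝ) ^ (n - 1) = x) (hy : (2:ℝ) ^ (n - 1) = y)
    (h : ((3 / 4) ^ 5 * (32 / 31 : ℝ) ^ 2) * ((7 / 8) ^ 5 * (32 / 31) ^ 3) ^ 2 * ((15 / 16) ^ 5 * (32 / 31) ^ 4) ^ 3
      * (2 ^ (n - 1)) ^ 5 ≤ (b:ℝ) ^ 5 * (32 / 31) ^ (n - 1))
    (hr : (r:ℝ) ^ 5 * x < ((3 / 4) ^ 5 * (32 / 31 : ℝ) ^ 2) * ((7 / 8) ^ 5 * (32 / 31) ^ 3) ^ 2 * ((15 / 16) ^ 5 * (32 / 31) ^ 4) ^ 3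
      * y ^ 5) : r < b := by
  rw [hx, hy] at h
  have hx0 : 0 < x := by rw [← hx]; positivity
  have h3 := lt_of_mul_lt_mul_right (hr.trans_le h) hx0.le
  exact_mod_cast lt_of_pow_lt_pow_left₀ 5 (by positivity) h3

lemma small_all (n b : ℕ) (hn : 3 ≤ n) (hn2 : n < 39) (hodd : Odd n)
    (h : ((3 / 4) ^ 5 * (32 / 31 : ℝ) ^ 2) * ((7 / 8) ^ 5 * (32 / 31) ^ 3) ^ 2 * ((15 / 16) ^ 5 * (32 / 31) ^ 4) ^ 3
      * (2 ^ (n - 1)) ^ 5 ≤ (b:ℝ) ^ 5 * (32 / 31) ^ (n - 1)) :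
    2 ^ n - 1 < b + Nat.totient (2 ^ n - 1) := by
  interval_cases n
  · have ht : Nat.totient (2 ^ 3 - 1) = 6 := by
      rw [show 2 ^ 3 - 1 = 7 by norm_num, Nat.totient_prime (show Nat.Prime 7 by norm_num)]
    have := small_ineq b 3 1 _ _ rfl rfl h (by norm_num)
    rw [ht]; norm_num; omega
  · exact absurd hodd (by decide)
  · have ht : Nat.totient (2 ^ 5 - 1) = 30 := by
      rw [show 2 ^ 5 - 1 = 31 by norm_num, Nat.totient_prime (show Nat.Prime 31 by norm_num)]
    have := small_ineq b 5 1 _ _ rfl rfl h (by norm_num)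
    rw [ht]; norm_num; omega
  · exact absurd hodd (by decide)
  · have ht : Nat.totient (2 ^ 7 - 1) = 126 := by
      rw [show 2 ^ 7 - 1 = 127 by norm_num, Nat.totient_prime (show Nat.Prime 127 by norm_num)]
    have := small_ineq b 7 1 _ _ rfl rfl h (by norm_num)
    rw [ht]; norm_num; omega
  · exact absurd hodd (by decide)
  · have ht : Nat.totient (2 ^ 9 - 1) = 432 := by
      rw [show 2 ^ 9 - 1 = 7 * (73) by norm_num, Nat.totient_mul (by norm_num), Nat.totient_prime (show Nat.Prime 7 by norm_num), Nat.totient_prime (show Nat.Prime 73 by norm_num)]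
    have := small_ineq b 9 79 _ _ rfl rfl h (by norm_num)
    rw [ht]; norm_num; omega
  · exact absurd hodd (by decide)
  · have ht : Nat.totient (2 ^ 11 - 1) = 1936 := by
      rw [show 2 ^ 11 - 1 = 23 * (89) by norm_num, Nat.totient_mul (by norm_num), Nat.totient_prime (show Nat.Prime 23 by norm_num), Nat.totient_prime (show Nat.Prime 89 by norm_num)]
    have := small_ineq b 11 111 _ _ rfl rfl h (by norm_num)
    rw [ht]; norm_num; omega
  · exact absurd hodd (by decide)
  · have ht : Nat.totient (2 ^ 13 - 1) = 8190 := by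
      rw [show 2 ^ 13 - 1 = 8191 by norm_num, Nat.totient_prime (show Nat.Prime 8191 by norm_num)]
    have := small_ineq b 13 1 _ _ rfl rfl h (by norm_num)
    rw [ht]; norm_num; omega
  · exact absurd hodd (by decide)
  · have ht : Nat.totient (2 ^ 15 - 1) = 27000 := by
      rw [show 2 ^ 15 - 1 = 7 * (31 * (151)) by norm_num, Nat.totient_mul (by norm_num), Nat.totient_mul (by norm_num), Nat.totient_prime (show Nat.Prime 7 by norm_num), Nat.totient_prime (show Nat.Prime 31 by norm_num), Nat.totient_prime (show Nat.Prime 151 by norm_num)]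
    have := small_ineq b 15 5767 _ _ rfl rfl h (by norm_num)
    rw [ht]; norm_num; omega
  · exact absurd hodd (by decide)
  · have ht : Nat.totient (2 ^ 17 - 1) = 131070 := by
      rw [show 2 ^ 17 - 1 = 131071 by norm_num, Nat.totient_prime (show Nat.Prime 131071 by norm_num)]
    have := small_ineq b 17 1 _ _ rfl rfl h (by norm_num)
    rw [ht]; norm_num; omega
  · exact absurd hodd (by decide)
  · have ht : Nat.totient (2 ^ 19 - 1) = 524286 := by
      rw [show 2 ^ 19 - 1 = 524287 by norm_num, Nat.totient_prime (show Nat.Prime 524287 by norm_num)]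
    have := small_ineq b 19 1 _ _ rfl rfl h (by norm_num)
    rw [ht]; norm_num; omega
  · exact absurd hodd (by decide)
  · have ht : Nat.totient (2 ^ 21 - 1) = 1778112 := by
      rw [show 2 ^ 21 - 1 = 49 * (127 * (337)) by norm_num, Nat.totient_mul (by norm_num), Nat.totient_mul (by norm_num), show Nat.totient 49 = 42 by decide, Nat.totient_prime (show Nat.Prime 127 by norm_num), Nat.totient_prime (show Nat.Prime 337 by norm_num)]
    have := small_ineq b 21 319039 _ _ rfl rfl h (by norm_num)
    rw [ht]; norm_num; omega
  · exact absurd hodd (by decide)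
  · have ht : Nat.totient (2 ^ 23 - 1) = 8210080 := by
      rw [show 2 ^ 23 - 1 = 47 * (178481) by norm_num, Nat.totient_mul (by norm_num), Nat.totient_prime (show Nat.Prime 47 by norm_num), Nat.totient_prime (show Nat.Prime 178481 by norm_num)]
    have := small_ineq b 23 178527 _ _ rfl rfl h (by norm_num)
    rw [ht]; norm_num; omega
  · exact absurd hodd (by decide)
  · have ht : Nat.totient (2 ^ 25 - 1) = 32400000 := by
      rw [show 2 ^ 25 - 1 = 31 * (601 * (1801)) by norm_num, Nat.totient_mul (by norm_num), Nat.totient_mul (by norm_num), Nat.totient_prime (show Nat.Prime 31 by norm_num), Nat.totient_prime (show Nat.Prime 601 by norm_num), Nat.totient_prime (show Nat.Prime 1801 by norm_num)]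
    have := small_ineq b 25 1154431 _ _ rfl rfl h (by norm_num)
    rw [ht]; norm_num; omega
  · exact absurd hodd (by decide)
  · have ht : Nat.totient (2 ^ 27 - 1) = 113467392 := by
      rw [show 2 ^ 27 - 1 = 7 * (73 * (262657)) by norm_num, Nat.totient_mul (by norm_num), Nat.totient_mul (by norm_num), Nat.totient_prime (show Nat.Prime 7 by norm_num), Nat.totient_prime (show Nat.Prime 73 by norm_num), Nat.totient_prime (show Nat.Prime 262657 by norm_num)]
    have := small_ineq b 27 20750335 _ _ rfl rfl h (by norm_num)
    rw [ht]; norm_num; omega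
  · exact absurd hodd (by decide)
  · have ht : Nat.totient (2 ^ 29 - 1) = 533826432 := by
      rw [show 2 ^ 29 - 1 = 233 * (1103 * (2089)) by norm_num, Nat.totient_mul (by norm_num), Nat.totient_mul (by norm_num), Nat.totient_prime (show Nat.Prime 233 by norm_num), Nat.totient_prime (show Nat.Prime 1103 by norm_num), Nat.totient_prime (show Nat.Prime 2089 by norm_num)]
    have := small_ineq b 29 3044479 _ _ rfl rfl h (by norm_num)
    rw [ht]; norm_num; omega
  · exact absurd hodd (by decide)
  · have ht : Nat.totient (2 ^ 31 - 1) = 2147483646 := by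
      rw [show 2 ^ 31 - 1 = 2147483647 by norm_num, Nat.totient_prime prime_M31]
    have := small_ineq b 31 1 _ _ rfl rfl h (by norm_num)
    rw [ht]; norm_num; omega
  · exact absurd hodd (by decide)
  · have ht : Nat.totient (2 ^ 33 - 1) = 6963536448 := by
      rw [show 2 ^ 33 - 1 = 7 * (23 * (89 * (599479))) by norm_num, Nat.totient_mul (by norm_num), Nat.totient_mul (by norm_num), Nat.totient_mul (by norm_num), Nat.totient_prime (show Nat.Prime 7 by norm_num), Nat.totient_prime (show Nat.Prime 23 by norm_num), Nat.totient_prime (show Nat.Prime 89 by norm_num), Nat.totient_prime (show Nat.Prime 599479 by norm_num)]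
    have := small_ineq b 33 1626398143 _ _ rfl rfl h (by norm_num)
    rw [ht]; norm_num; omega
  · exact absurd hodd (by decide)
  · have ht : Nat.totient (2 ^ 35 - 1) = 32524632000 := by
      rw [show 2 ^ 35 - 1 = 31 * (71 * (127 * (122921))) by norm_num, Nat.totient_mul (by norm_num), Nat.totient_mul (by norm_num), Nat.totient_mul (by norm_num), Nat.totient_prime (show Nat.Prime 31 by norm_num), Nat.totient_prime (show Nat.Prime 71 by norm_num), Nat.totient_prime (show Nat.Prime 127 by norm_num), Nat.totient_prime (show Nat.Prime 122921 by norm_num)]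
    have := small_ineq b 35 1835106367 _ _ rfl rfl h (by norm_num)
    rw [ht]; norm_num; omega
  · exact absurd hodd (by decide)
  · have ht : Nat.totient (2 ^ 37 - 1) = 136822635072 := by
      rw [show 2 ^ 37 - 1 = 223 * (616318177) by norm_num, Nat.totient_mul (by norm_num), Nat.totient_prime (show Nat.Prime 223 by norm_num), Nat.totient_prime prime_big]
    have := small_ineq b 37 616318399 _ _ rfl rfl h (by norm_num)
    rw [ht]; norm_num; omega
  · exact absurd hodd (by decide)

lemma w_big (d : ℕ) (hd : 6 ≤ d) : (1:ℝ) ≤ ((2:ℝ) ^ d - 1) ^ 5 / 2 ^ (4 * d + 5) := by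
  rw [one_le_div (by positivity)]
  have h : (64:ℝ) ≤ 2 ^ d := by
    calc (64:ℝ) = 2 ^ 6 := by norm_num
      _ ≤ 2 ^ d := pow_le_pow_right₀ (by norm_num) hd
  have h1 : (63 / 64 : ℝ) * 2 ^ d ≤ 2 ^ d - 1 := by linarith
  calc (2:ℝ) ^ (4 * d + 5) = (2 ^ d) ^ 4 * 32 := by rw [pow_add, mul_comm 4 d, pow_mul]; norm_num
    _ ≤ (2 ^ d) ^ 4 * ((63 / 64) ^ 5 * 2 ^ d) := by gcongr; linarith
    _ = ((63 / 64 : ℝ) * 2 ^ d) ^ 5 := by ring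
    _ ≤ _ := by gcongr

lemma w_small (d : ℕ) (hd : 6 ≤ d) : (1:ℝ) ≤ (((2:ℝ) ^ d - 1) / 2 ^ d) ^ 5 * (32 / 31) ^ d := by
  have h : (64:ℝ) ≤ 2 ^ d := by
    calc (64:ℝ) = 2 ^ 6 := by norm_num
      _ ≤ 2 ^ d := pow_le_pow_right₀ (by norm_num) hd
  have h1 : (63 / 64 : ℝ) ≤ (2 ^ d - 1) / 2 ^ d := by
    rw [le_div_iff₀ (by positivity)]; linarith
  calc (1:ℝ) ≤ (63 / 64) ^ 5 * (32 / 31) ^ 6 := by norm_num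
    _ ≤ (((2:ℝ) ^ d - 1) / 2 ^ d) ^ 5 * (32 / 31) ^ d := by
      gcongr
      norm_num

lemma prim_of_count {K : Type} [Field K] [Fintype K] (B : Finset K) (hB0 : 0 ∉ B)
    (hB : Fintype.card K - 1 < B.card + Nat.totient (Fintype.card K - 1)) :
    ∃ α ∈ B, ∀ b : K, b ≠ 0 → ∃ m : ℕ, α ^ m = b := by
  classical
  have hcard : Fintype.card Kˣ = Fintype.card K - 1 := Fintype.card_units K
  have hG : (Finset.univ.filter (fun u : Kˣ => orderOf u = Fintype.card Kˣ)).card =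
      Nat.totient (Fintype.card K - 1) := by
    rw [IsCyclic.card_orderOf_eq_totient dvd_rfl, hcard]
  set G := Finset.univ.filter (fun u : Kˣ => orderOf u = Fintype.card Kˣ) with hGdef
  set G' : Finset K := G.image Units.val with hG'
  have hG'c : G'.card = Nat.totient (Fintype.card K - 1) := by
    rw [hG', Finset.card_image_of_injective _ Units.val_injective, hG]
  have hnd : ¬ Disjoint B G' := by
    intro hd
    have h1 := Finset.card_union_of_disjoint hd
    have h2 : B ∪ G' ⊆ Finset.univ.erase 0 := by
      intro x hx
      rw [Finset.mem_erase]
      refine ⟨?_, Finset.mem_univ _⟩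
      rintro rfl
      rcases Finset.mem_union.mp hx with h | h
      · exact hB0 h
      · obtain ⟨u, -, hu⟩ := Finset.mem_image.mp h
        exact u.ne_zero hu
    have h3 := Finset.card_le_card h2
    rw [Finset.card_erase_of_mem (Finset.mem_univ _), Finset.card_univ] at h3
    omega
  obtain ⟨α, hα, hα2⟩ := Finset.not_disjoint_iff.mp hnd
  obtain ⟨u, hu, rfl⟩ := Finset.mem_image.mp hα2
  refine ⟨u, hα, ?_⟩
  have hou : orderOf u = Nat.card Kˣ := by
    rw [Nat.card_eq_fintype_card]; exact (Finset.mem_filter.mp hu).2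
  intro b hb
  have hmem : Units.mk0 b hb ∈ Subgroup.zpowers u := by
    have : Subgroup.zpowers u = ⊤ := (Subgroup.card_eq_iff_eq_top _).mp (by rw [Nat.card_zpowers, hou])
    rw [this]; trivial
  rw [mem_zpowers_iff_mem_range_orderOf] at hmem
  obtain ⟨m, -, hm⟩ := Finset.mem_image.mp hmem
  refine ⟨m, ?_⟩
  have := congrArg Units.val hm
  simpa using this

/-- For every odd `n ≥ 3` there is a primitive `1`-normal element of `F_{2ⁿ}` over `F_2`. -/
theorem stmt_7 (n : ℕ) (hn : 3 ≤ n) (hodd : Odd n)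
    (K : Type) [Field K] [Fintype K] [Algebra (ZMod 2) K]
    (hrK : Module.finrank (ZMod 2) K = n) :
    ∃ α : K, IsPrimitiveElt α ∧ IskNormal 2 n 1 (ZMod 2) α := by
  classical
  have hcard : Fintype.card K = 2 ^ n := by
    rw [Module.card_eq_pow_finrank (K := ZMod 2) (V := K), ZMod.card, hrK]
  obtain ⟨T, hT, hT2, hcop, hcnt⟩ := exists_factors n hn hodd
  have hT0 : ∀ s ∈ T, s ≠ 0 := fun s hs => (hT2 s hs).1.ne_zero
  have hdeg : ∑ g ∈ T, g.natDegree = n - 1 := by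
    have h1 := congrArg natDegree hT
    have hX1m : (X - 1 : (ZMod 2)[X]).Monic := monic_X_sub_C 1
    have hX1d : (X - 1 : (ZMod 2)[X]).natDegree = 1 := by
      rw [show (X - 1 : (ZMod 2)[X]) = X - C 1 by simp, natDegree_X_sub_C]
    have hXn : (X ^ n - 1 : (ZMod 2)[X]).natDegree = n := by
      rw [show (X ^ n - 1 : (ZMod 2)[X]) = X ^ n - C 1 by simp, natDegree_X_pow_sub_C]
    rw [hX1m.natDegree_mul (monic_prod_of_monic _ _ (fun g hg => (hT2 g hg).1)), hX1d, hXn,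
      natDegree_prod_of_monic _ _ (fun g hg => (hT2 g hg).1)] at h1
    omega
  have hTne : T.Nonempty := by
    rw [Finset.nonempty_iff_ne_empty]
    rintro rfl
    simp at hdeg
    omega
  set B := Eset K T 1 with hB
  have hB0 : (0:K) ∉ B := by
    intro h0
    obtain ⟨g, hg⟩ := hTne
    exact (mem_Eset.mp h0).2 g hg (∏ x ∈ T.erase g, x)
      (by rw [one_mul, Finset.prod_erase_mul _ _ hg]) (map_zero _)
  have hBc : (B.card : ℝ) = ∏ g ∈ T, ((2:ℝ) ^ g.natDegree - 1) := by
    rw [hB, Eset_card n (by omega) K hrK T hT0 hcop 1 (by rw [one_mul, ← hT]; exact Dvd.intro_left _ rfl)]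
    simp
  have key : ∃ α ∈ B, ∀ b : K, b ≠ 0 → ∃ m : ℕ, α ^ m = b := by
    have hpow : ∀ c : ℝ, ∏ g ∈ T, c ^ g.natDegree = c ^ (n - 1) := by
      intro c
      rw [Finset.prod_pow_eq_pow_sum, hdeg]
    rcases lt_or_ge n 39 with hlt | hge
    · apply prim_of_count B hB0
      rw [hcard]
      apply small_all n B.card hn hlt hodd
      have := prod_w T (fun g hg => (hT2 g hg).2.2) hcnt
        (fun d => (((2:ℝ) ^ d - 1) / 2 ^ d) ^ 5 * (32 / 31) ^ d)
        (by intro d hd; rw [Finset.mem_Icc] at hd; obtain ⟨h1, h2⟩ := hd; interval_cases d <;> norm_num)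
        (by intro d hd; rw [Finset.mem_Icc] at hd; obtain ⟨h1, h2⟩ := hd; interval_cases d <;> norm_num)
        w_small
      rw [Finset.prod_mul_distrib, hpow, Finset.prod_pow, Finset.prod_div_distrib, hpow, ← hBc,
        div_pow (B.card : ℝ), div_mul_eq_mul_div ((B.card : ℝ) ^ 5), le_div_iff₀ (by positivity)] at this
      refine le_trans (le_of_eq ?_) this
      congr 1
      norm_num
    · apply exists_prim B hB0 (2 ^ T.card * √(2 ^ n))
      · intro η hη
        apply Eset_char K η _ _ T hT0 hcop 1
        intro V W hW
        have := char_subgroup η hη W ((hW 0).mpr V.zero_mem)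
          (fun x hx y hy => (hW _).mpr (V.add_mem ((hW _).mp hx) ((hW _).mp hy)))
        rw [hcard] at this
        push_cast at this
        exact this
      · have := prod_w T (fun g hg => (hT2 g hg).2.2) hcnt
          (fun d => ((2:ℝ) ^ d - 1) ^ 5 / 2 ^ (4 * d + 5))
          (by intro d hd; rw [Finset.mem_Icc] at hd; obtain ⟨h1, h2⟩ := hd; interval_cases d <;> norm_num)
          (by intro d hd; rw [Finset.mem_Icc] at hd; obtain ⟨h1, h2⟩ := hd; interval_cases d <;> norm_num)
          w_big
        have e : ∏ g ∈ T, (2:ℝ) ^ (4 * g.natDegree + 5) = (2 ^ n / 2) ^ 4 * (2 ^ T.card) ^ 5 := by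
          have h1 : ∀ g ∈ T, (2:ℝ) ^ (4 * g.natDegree + 5) = (2 ^ 4) ^ g.natDegree * 2 ^ 5 := by
            intro g _; rw [pow_add, pow_mul]
          rw [Finset.prod_congr rfl h1, Finset.prod_mul_distrib, hpow, Finset.prod_const]
          have h2 : (2:ℝ) ^ n / 2 = 2 ^ (n - 1) := by
            obtain ⟨m, rfl⟩ : ∃ m, n = m + 1 := ⟨n - 1, by omega⟩
            rw [pow_succ]; simp
          rw [h2, ← pow_mul, ← pow_mul, ← pow_mul, ← pow_mul, mul_comm 4, mul_comm 5]
        rw [Finset.prod_div_distrib, Finset.prod_pow, ← hBc, e, le_div_iff₀ (by positivity)] at this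
        have hbpos : (0:ℝ) < B.card := by
          rw [hBc]
          apply Finset.prod_pos
          intro g hg
          rw [sub_pos]
          exact one_lt_pow₀ (by norm_num) (by have := (hT2 g hg).2.2; omega)
        have h1 : (3 ^ 5 / 2 ^ 13) * (7 ^ 5 / 2 ^ 17) ^ 2 * (15 ^ 5 / 2 ^ 21) ^ 3 * (31 ^ 5 / 2 ^ 25) ^ 6 *
            (((2:ℝ) ^ n / 2) ^ 4 * (2 ^ T.card) ^ 5) ≤ (B.card : ℝ) ^ 5 := by
          refine le_trans (le_of_eq ?_) this
          congr 1
          norm_num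
        have h2 := omega_bound n hodd
        have h3 : (2:ℝ) ^ 39 ≤ 2 ^ n := pow_le_pow_right₀ (by norm_num) hge
        rw [hcard]
        generalize (2 ^ n - 1).primeFactors.card = ω at h2 ⊢
        generalize (2:ℝ) ^ n = y at h1 h2 h3 ⊢
        have hw : (0:ℝ) < 2 ^ ω := by positivity
        have hk : (0:ℝ) < 2 ^ T.card := by positivity
        generalize (2:ℝ) ^ ω = w at h2 hw ⊢
        generalize (2:ℝ) ^ T.card = k at h1 hk ⊢
        generalize (B.card : ℝ) = b at h1 hbpos ⊢
        have hm := big_ineq b y w k hbpos h3 hw hk h1 h2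
        refine lt_of_le_of_lt ?_ hm
        have : 0 ≤ k * √y := by positivity
        linarith
  obtain ⟨α, hα, hp⟩ := key
  exact ⟨α, hp, Eset_normal n hn K hrK T hT hT2 α hα⟩

end
end
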